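/- arXiv:2509.03648 — 13 statements merged into one kernel-verified Lean document; each statement's English description precedes it below -/
import Mathlib

section
/- Let (D, ⊣, ⊢) be a diassociative algebra. Define operations on D by a·b := a⊣b + a⊢b, {a,b,c} := −(a⊢b)⊢c, and ⦃a,b,c⦄ := −(a⊣b)⊣c. Then (D, ·, { , , }, ⦃ , , ⦄) is an associative-Yamaguti algebra, i.e. the identities (AY1)–(AY11) hold; moreover {a,b,c} = −(a⊣b)⊢c = −(a⊢b)⊢c = −a⊢(b⊢c) and ⦃a,b,c⦄ = −a⊣(b⊢c) = −a⊣(b⊣c) = −(a⊣b)⊣c for all a,b,c ∈ D. -/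
set_option maxHeartbeats 1000000

/-- A diassociative algebra structure: two bilinear associative operations
`dl` (`⊣`) and `dr` (`⊢`) satisfying the three diassociative axioms. -/
structure IsDiassociative {k D : Type*} [Field k] [AddCommGroup D] [Module k D]
    (dl dr : D →ₗ[k] D →ₗ[k] D) : Prop where
  assoc_l : ∀ a b c : D, dl (dl a b) c = dl a (dl b c)
  assoc_r : ∀ a b c : D, dr (dr a b) c = dr a (dr b c)
  di1 : ∀ a b c : D, dl a (dl b c) = dl a (dr b c)
  di2 : ∀ a b c : D, dl (dr a b) c = dr a (dl b c)
  di3 : ∀ a b c : D, dr (dr a b) c = dr (dl a b) c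

/-- An associative-Yamaguti algebra structure: a bilinear multiplication `mul` and
trilinear operations `tri` (`{ , , }`) and `tri'` (`⦃ , , ⦄`) satisfying (AY1)-(AY11). -/
structure IsAssYamaguti {k A : Type*} [Field k] [AddCommGroup A] [Module k A]
    (mul : A →ₗ[k] A →ₗ[k] A) (tri tri' : A →ₗ[k] A →ₗ[k] A →ₗ[k] A) : Prop where
  ay1 : ∀ a b c : A, mul (mul a b) c - mul a (mul b c) + tri a b c - tri' a b c = 0
  ay2 : ∀ a b c d : A, tri (mul a b) c d = tri a (mul b c) d
  ay3 : ∀ a b c d : A, tri a b (mul c d) = mul (tri a b c) d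
  ay4 : ∀ a b c d : A, tri' (mul a b) c d = mul a (tri' b c d)
  ay5 : ∀ a b c d : A, tri' a (mul b c) d = tri' a b (mul c d)
  ay6 : ∀ a b c d : A, mul a (tri b c d) = mul (tri' a b c) d
  ay7a : ∀ a b c d e : A, tri (tri a b c) d e = tri a (tri' b c d) e
  ay7b : ∀ a b c d e : A, tri a (tri' b c d) e = tri a b (tri c d e)
  ay8 : ∀ a b c d e : A, tri a (tri b c d) e = tri (tri' a b c) d e
  ay9a : ∀ a b c d e : A, tri' (tri' a b c) d e = tri' a (tri b c d) e
  ay9b : ∀ a b c d e : A, tri' a (tri b c d) e = tri' a b (tri' c d e)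
  ay10 : ∀ a b c d e : A, tri' a (tri' b c d) e = tri' a b (tri c d e)
  ay11 : ∀ a b c d e : A, tri a b (tri' c d e) = tri' (tri a b c) d e

namespace IsDiassociative

variable {k D : Type*} [Field k] [AddCommGroup D] [Module k D] {dl dr : D →ₗ[k] D →ₗ[k] D}

theorem dl_dl_eq_dl_dr (h : IsDiassociative dl dr) (a b c : D) :
    dl (dl a b) c = dl a (dr b c) := by
  rw [h.assoc_l, h.di1]

theorem dr_dl_eq_dr_dr (h : IsDiassociative dl dr) (a b c : D) :
    dr (dl a b) c = dr a (dr b c) := by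
  rw [← h.di3, h.assoc_r]

theorem dl_dr_dl (h : IsDiassociative dl dr) (a b c d : D) :
    dl a (dr b (dl c d)) = dl a (dr b (dr c d)) := by
  rw [← h.di2, h.di1, h.assoc_r]

end IsDiassociative

/-- any diassociative algebra `(D, ⊣ = dl, ⊢ = dr)` yields an
associative-Yamaguti algebra with `a·b = a⊣b + a⊢b`, `{a,b,c} = -(a⊢b)⊢c` and
`⦃a,b,c⦄ = -(a⊣b)⊣c`; moreover the alternative formulas for `{ , , }` and `⦃ , , ⦄` hold. -/
theorem diassociative_to_assYamaguti {k D : Type*} [Field k] [CharZero k]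
    [AddCommGroup D] [Module k D]
    (dl dr : D →ₗ[k] D →ₗ[k] D) (h : IsDiassociative dl dr) :
    ∃ (mul : D →ₗ[k] D →ₗ[k] D) (tri tri' : D →ₗ[k] D →ₗ[k] D →ₗ[k] D),
      (∀ a b : D, mul a b = dl a b + dr a b) ∧
      (∀ a b c : D, tri a b c = -(dr (dr a b) c) ∧ tri a b c = -(dr (dl a b) c) ∧
        tri a b c = -(dr a (dr b c))) ∧
      (∀ a b c : D, tri' a b c = -(dl (dl a b) c) ∧ tri' a b c = -(dl a (dr b c)) ∧
        tri' a b c = -(dl a (dl b c))) ∧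
      IsAssYamaguti mul tri tri' := by
  refine ⟨dl + dr, -(dr.compr₂ dr), -(dl.compr₂ dl), fun a b => rfl, fun a b c => ?_,
    fun a b c => ?_, ?_⟩
  · simp [h.assoc_r, h.dr_dl_eq_dr_dr]
  · simp [h.di1, h.dl_dl_eq_dl_dr]
  · constructor <;> intros <;>
      simp only [LinearMap.add_apply, LinearMap.neg_apply, LinearMap.compr₂_apply, map_add,
        map_neg, h.dl_dl_eq_dl_dr, h.di1, h.di2, h.assoc_r, h.dr_dl_eq_dr_dr, h.dl_dr_dl] <;>
      abel
end

section
/- Let (A, ·) be an associative algebra with a reductive decomposition A = A₀ ⊕ A₁, i.e. a direct sum of subspaces with A₀·A₀ ⊆ A₀, A₀·A₁ ⊆ A₁ and A₁·A₀ ⊆ A₁. For a,b,c ∈ A₁ define a•b := pr₁(a·b), {a,b,c} := (pr₀(a·b))·c and ⦃a,b,c⦄ := a·(pr₀(b·c)), where pr₀ and pr₁ are the projections onto A₀ and A₁. Then (A₁, •, { , , }, ⦃ , , ⦄) is an associative-Yamaguti algebra, i.e. the identities (AY1)–(AY11) hold. -/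
set_option maxHeartbeats 1000000

/-- The product `a • b := pr₁(a·b)` on `A₁` induced by a reductive decomposition. -/
def redMul {k A : Type*} [Field k] [AddCommGroup A] [Module k A]
    (m : A →ₗ[k] A →ₗ[k] A) (pr1 : A →ₗ[k] A) (a b : A) : A :=
  pr1 (m a b)

/-- The operation `{a,b,c} := (pr₀(a·b))·c` on `A₁`. -/
def redTri {k A : Type*} [Field k] [AddCommGroup A] [Module k A]
    (m : A →ₗ[k] A →ₗ[k] A) (pr0 : A →ₗ[k] A) (a b c : A) : A :=
  m (pr0 (m a b)) c

/-- The operation `⦃a,b,c⦄ := a·(pr₀(b·c))` on `A₁`. -/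
def redTri' {k A : Type*} [Field k] [AddCommGroup A] [Module k A]
    (m : A →ₗ[k] A →ₗ[k] A) (pr0 : A →ₗ[k] A) (a b c : A) : A :=
  m a (pr0 (m b c))

/-- Operations on a submodule `S` forming an associative-Yamaguti algebra:
the operations are closed on `S` and satisfy the identities (AY1)-(AY11) on `S`. -/
structure IsAssYamagutiOn {k A : Type*} [Field k] [AddCommGroup A] [Module k A]
    (S : Submodule k A) (mul : A → A → A) (tri tri' : A → A → A → A) : Prop where
  mem_mul : ∀ a ∈ S, ∀ b ∈ S, mul a b ∈ S
  mem_tri : ∀ a ∈ S, ∀ b ∈ S, ∀ c ∈ S, tri a b c ∈ S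
  mem_tri' : ∀ a ∈ S, ∀ b ∈ S, ∀ c ∈ S, tri' a b c ∈ S
  ay1 : ∀ a ∈ S, ∀ b ∈ S, ∀ c ∈ S,
    mul (mul a b) c - mul a (mul b c) + tri a b c - tri' a b c = 0
  ay2 : ∀ a ∈ S, ∀ b ∈ S, ∀ c ∈ S, ∀ d ∈ S, tri (mul a b) c d = tri a (mul b c) d
  ay3 : ∀ a ∈ S, ∀ b ∈ S, ∀ c ∈ S, ∀ d ∈ S, tri a b (mul c d) = mul (tri a b c) d
  ay4 : ∀ a ∈ S, ∀ b ∈ S, ∀ c ∈ S, ∀ d ∈ S, tri' (mul a b) c d = mul a (tri' b c d)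
  ay5 : ∀ a ∈ S, ∀ b ∈ S, ∀ c ∈ S, ∀ d ∈ S, tri' a (mul b c) d = tri' a b (mul c d)
  ay6 : ∀ a ∈ S, ∀ b ∈ S, ∀ c ∈ S, ∀ d ∈ S, mul a (tri b c d) = mul (tri' a b c) d
  ay7a : ∀ a ∈ S, ∀ b ∈ S, ∀ c ∈ S, ∀ d ∈ S, ∀ e ∈ S,
    tri (tri a b c) d e = tri a (tri' b c d) e
  ay7b : ∀ a ∈ S, ∀ b ∈ S, ∀ c ∈ S, ∀ d ∈ S, ∀ e ∈ S,
    tri a (tri' b c d) e = tri a b (tri c d e)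
  ay8 : ∀ a ∈ S, ∀ b ∈ S, ∀ c ∈ S, ∀ d ∈ S, ∀ e ∈ S,
    tri a (tri b c d) e = tri (tri' a b c) d e
  ay9a : ∀ a ∈ S, ∀ b ∈ S, ∀ c ∈ S, ∀ d ∈ S, ∀ e ∈ S,
    tri' (tri' a b c) d e = tri' a (tri b c d) e
  ay9b : ∀ a ∈ S, ∀ b ∈ S, ∀ c ∈ S, ∀ d ∈ S, ∀ e ∈ S,
    tri' a (tri b c d) e = tri' a b (tri' c d e)
  ay10 : ∀ a ∈ S, ∀ b ∈ S, ∀ c ∈ S, ∀ d ∈ S, ∀ e ∈ S,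
    tri' a (tri' b c d) e = tri' a b (tri c d e)
  ay11 : ∀ a ∈ S, ∀ b ∈ S, ∀ c ∈ S, ∀ d ∈ S, ∀ e ∈ S,
    tri a b (tri' c d e) = tri' (tri a b c) d e

/-- given an associative algebra `(A, m)` with a reductive decomposition
`A = A₀ ⊕ A₁` (with projections `pr0`, `pr1`), the operations `a • b = pr₁(a·b)`,
`{a,b,c} = (pr₀(a·b))·c` and `⦃a,b,c⦄ = a·(pr₀(b·c))` make `A₁` an
associative-Yamaguti algebra. -/
theorem reductive_to_assYamaguti {k A : Type*} [Field k] [CharZero k]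
    [AddCommGroup A] [Module k A]
    (m : A →ₗ[k] A →ₗ[k] A)
    (massoc : ∀ a b c : A, m (m a b) c = m a (m b c))
    (A0 A1 : Submodule k A)
    (pr0 pr1 : A →ₗ[k] A)
    (hsum : ∀ x : A, pr0 x + pr1 x = x)
    (hpr0 : ∀ x : A, pr0 x ∈ A0) (hpr1 : ∀ x : A, pr1 x ∈ A1)
    (hid0 : ∀ x ∈ A0, pr0 x = x) (hid1 : ∀ x ∈ A1, pr1 x = x)
    (h00 : ∀ a ∈ A0, ∀ b ∈ A0, m a b ∈ A0)
    (h01 : ∀ a ∈ A0, ∀ b ∈ A1, m a b ∈ A1)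
    (h10 : ∀ a ∈ A1, ∀ b ∈ A0, m a b ∈ A1) :
    IsAssYamagutiOn A1 (redMul m pr1) (redTri m pr0) (redTri' m pr0) := by
  have z0 : ∀ x ∈ A1, pr0 x = 0 := fun x hx => by
    have h := hsum x
    rwa [hid1 x hx, add_eq_right] at h
  have z1 : ∀ x ∈ A0, pr1 x = 0 := fun x hx => by
    have h := hsum x
    rwa [hid0 x hx, add_eq_left] at h
  have pr0_left : ∀ x y, pr0 (m (pr0 x) y) = m (pr0 x) (pr0 y) := fun x y => by
    conv_lhs => rw [← hsum y]
    rw [map_add, map_add, hid0 _ (h00 _ (hpr0 x) _ (hpr0 y)),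
      z0 _ (h01 _ (hpr0 x) _ (hpr1 y)), add_zero]
  have pr1_left : ∀ x y, pr1 (m (pr0 x) y) = m (pr0 x) (pr1 y) := fun x y => by
    conv_lhs => rw [← hsum y]
    rw [map_add, map_add, z1 _ (h00 _ (hpr0 x) _ (hpr0 y)),
      hid1 _ (h01 _ (hpr0 x) _ (hpr1 y)), zero_add]
  have pr0_right : ∀ x y, pr0 (m x (pr0 y)) = m (pr0 x) (pr0 y) := fun x y => by
    conv_lhs => rw [← hsum x]
    rw [map_add, LinearMap.add_apply, map_add, hid0 _ (h00 _ (hpr0 x) _ (hpr0 y)),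
      z0 _ (h10 _ (hpr1 x) _ (hpr0 y)), add_zero]
  have pr1_right : ∀ x y, pr1 (m x (pr0 y)) = m (pr1 x) (pr0 y) := fun x y => by
    conv_lhs => rw [← hsum x]
    rw [map_add, LinearMap.add_apply, map_add, z1 _ (h00 _ (hpr0 x) _ (hpr0 y)),
      hid1 _ (h10 _ (hpr1 x) _ (hpr0 y)), zero_add]
  have split : ∀ a b c, m (pr0 (m a b)) c + m (pr1 (m a b)) c
      = m a (pr0 (m b c)) + m a (pr1 (m b c)) := fun a b c => by
    rw [← LinearMap.add_apply, ← map_add, ← map_add, hsum, hsum, massoc]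
  have split0 : ∀ a ∈ A1, ∀ b, ∀ c ∈ A1,
      pr0 (m (pr1 (m a b)) c) = pr0 (m a (pr1 (m b c))) := fun a ha b c hc => by
    have h := congrArg pr0 (split a b c)
    rwa [map_add, map_add, pr0_left, pr0_right, z0 a ha, z0 c hc, map_zero, map_zero,
      LinearMap.zero_apply, zero_add, zero_add] at h
  have split1 : ∀ a ∈ A1, ∀ b, ∀ c ∈ A1,
      m (pr0 (m a b)) c + pr1 (m (pr1 (m a b)) c)
        = m a (pr0 (m b c)) + pr1 (m a (pr1 (m b c))) := fun a ha b c hc => by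
    have h := congrArg pr1 (split a b c)
    rwa [map_add, map_add, pr1_left, pr1_right, hid1 a ha, hid1 c hc] at h
  have pr0_assoc : ∀ a b x, pr0 (m a (m b (pr0 x))) = m (pr0 (m a b)) (pr0 x) :=
    fun a b x => by rw [← massoc, pr0_right]
  constructor <;> simp only [redMul, redTri, redTri']
  case mem_mul => exact fun a _ b _ => hpr1 _
  case mem_tri => exact fun a _ b _ c hc => h01 _ (hpr0 _) _ hc
  case mem_tri' => exact fun a ha b _ c _ => h10 _ ha _ (hpr0 _)
  case ay1 =>
    intro a ha b _ c hc
    rw [sub_add_eq_add_sub, sub_sub, sub_eq_zero, add_comm, split1 a ha b c hc, add_comm]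
  case ay2 => exact fun a ha b _ c hc d _ => by rw [split0 a ha b c hc]
  case ay3 => exact fun a _ b _ c _ d _ => by rw [massoc, pr1_left]
  case ay4 => exact fun a _ b _ c _ d _ => by rw [← massoc, pr1_right]
  case ay5 => exact fun a _ b hb c _ d hd => by rw [split0 b hb c d hd]
  all_goals
    intros
    simp only [massoc, pr0_left, pr0_assoc]
end

section
/- Let (A, ·, { , , }, ⦃ , , ⦄) be an associative-Yamaguti algebra and let (B, *) be an associative algebra with bilinear maps ⊳ : B × A → A and ⊲ : A × B → A making A a bimodule over (B, *) (i.e. (ξ*η)⊳a = ξ⊳(η⊳a), a⊲(ξ*η) = (a⊲ξ)⊲η, (ξ⊳a)⊲η = ξ⊳(a⊲η)) and satisfying ξ⊳(a·b) = (ξ⊳a)·b, (a·b)⊲ξ = a·(b⊲ξ), a·(ξ⊳b) = (a⊲ξ)·b. Let Δ : A × A → B be a bilinear map with Δ(a,b)⊳c = {a,b,c}, a⊲Δ(b,c) = ⦃a,b,c⦄, ξ*Δ(a,b) = Δ(ξ⊳a, b), Δ(a,b)*ξ = Δ(a, b⊲ξ), Δ(a, ξ⊳b) = Δ(a⊲ξ,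 b), and Δ(a·b, c) = Δ(a, b·c) for all a,b,c ∈ A, ξ,η ∈ B. Then the operation (ξ,a) ⊛ (η,b) := (ξ*η + Δ(a,b), ξ⊳b + a⊲η + a·b) makes B ⊕ A an associative algebra. -/
set_option maxHeartbeats 1000000

/-- The product `(ξ,a) ⊛ (η,b) = (ξ*η + Δ(a,b), ξ⊳b + a⊲η + a·b)` on `B ⊕ A`. -/
def envMul {k A B : Type*} [Field k] [AddCommGroup A] [Module k A]
    [AddCommGroup B] [Module k B]
    (mulB : B →ₗ[k] B →ₗ[k] B) (mul : A →ₗ[k] A →ₗ[k] A)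
    (tl : B →ₗ[k] A →ₗ[k] A) (tr : A →ₗ[k] B →ₗ[k] A)
    (Δ : A →ₗ[k] A →ₗ[k] B) (p q : B × A) : B × A :=
  (mulB p.1 q.1 + Δ p.2 q.2, tl p.1 q.2 + tr p.2 q.1 + mul p.2 q.2)

/-- given an associative-Yamaguti algebra `(A, mul, tri, tri')`,
an associative algebra `(B, mulB)` acting on `A` by a bimodule structure `(tl, tr)`
compatible with `mul`, and a map `Δ : A × A → B` satisfying the stated conditions,
the product `(ξ,a) ⊛ (η,b) = (ξ*η + Δ(a,b), ξ⊳b + a⊲η + a·b)` is associative on `B ⊕ A`. -/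
theorem enveloping_assoc {k A B : Type*} [Field k] [CharZero k]
    [AddCommGroup A] [Module k A] [AddCommGroup B] [Module k B]
    (mul : A →ₗ[k] A →ₗ[k] A) (tri tri' : A →ₗ[k] A →ₗ[k] A →ₗ[k] A)
    (hA : IsAssYamaguti mul tri tri')
    (mulB : B →ₗ[k] B →ₗ[k] B)
    (hBassoc : ∀ ξ η ζ : B, mulB (mulB ξ η) ζ = mulB ξ (mulB η ζ))
    (tl : B →ₗ[k] A →ₗ[k] A) (tr : A →ₗ[k] B →ₗ[k] A)
    (hbm1 : ∀ (ξ η : B) (a : A), tl (mulB ξ η) a = tl ξ (tl η a))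
    (hbm2 : ∀ (a : A) (ξ η : B), tr a (mulB ξ η) = tr (tr a ξ) η)
    (hbm3 : ∀ (ξ : B) (a : A) (η : B), tr (tl ξ a) η = tl ξ (tr a η))
    (hc1 : ∀ (ξ : B) (a b : A), tl ξ (mul a b) = mul (tl ξ a) b)
    (hc2 : ∀ (a b : A) (ξ : B), tr (mul a b) ξ = mul a (tr b ξ))
    (hc3 : ∀ (a : A) (ξ : B) (b : A), mul a (tl ξ b) = mul (tr a ξ) b)
    (Δ : A →ₗ[k] A →ₗ[k] B)
    (hd1 : ∀ a b c : A, tl (Δ a b) c = tri a b c)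
    (hd2 : ∀ a b c : A, tr a (Δ b c) = tri' a b c)
    (hd3 : ∀ (ξ : B) (a b : A), mulB ξ (Δ a b) = Δ (tl ξ a) b)
    (hd4 : ∀ (a b : A) (ξ : B), mulB (Δ a b) ξ = Δ a (tr b ξ))
    (hd5 : ∀ (a : A) (ξ : B) (b : A), Δ a (tl ξ b) = Δ (tr a ξ) b)
    (hd6 : ∀ a b c : A, Δ (mul a b) c = Δ a (mul b c)) :
    ∀ p q r : B × A,
      envMul mulB mul tl tr Δ (envMul mulB mul tl tr Δ p q) r =
        envMul mulB mul tl tr Δ p (envMul mulB mul tl tr Δ q r) := by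
  rintro ⟨ξ, a⟩ ⟨η, b⟩ ⟨ζ, c⟩
  have h : mul (mul a b) c + tri a b c = mul a (mul b c) + tri' a b c := by
    rw [← sub_eq_zero, ← hA.ay1 a b c]
    abel
  ext
  · simp only [envMul, map_add, LinearMap.add_apply, hBassoc, hd3, hd4, hd5, hd6]
    abel
  · simp only [envMul, map_add, LinearMap.add_apply, hbm1, hbm2, hbm3, hc1, hc2, hc3, hd1, hd2]
    linear_combination (norm := abel) h
end

section
/- Let (A, ·, { , , }, ⦃ , , ⦄) be an associative-Yamaguti algebra. Define [a,b] := a·b − b·a and ⟦a,b,c⟧ := {a,b,c} − {b,a,c} − ⦃c,a,b⦄ + ⦃c,b,a⦄ for a,b,c ∈ A. Then (A, [ , ], ⟦ , , ⟧) is a Lie-Yamaguti algebra, i.e. [ , ] is skew-symmetric, ⟦ , , ⟧ is skew-symmetric in its first two arguments, and the identities (LY1)–(LY4) hold. -/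
set_option maxHeartbeats 1000000

/-- A Lie-Yamaguti algebra structure: a skew-symmetric bilinear bracket `br` and a
trilinear bracket `tr`, skew-symmetric in its first two arguments, satisfying (LY1)-(LY4). -/
structure IsLieYamaguti {k g : Type*} [Field k] [AddCommGroup g] [Module k g]
    (br : g →ₗ[k] g →ₗ[k] g) (tr : g →ₗ[k] g →ₗ[k] g →ₗ[k] g) : Prop where
  skew : ∀ x y : g, br x y = - br y x
  skew3 : ∀ x y z : g, tr x y z = - tr y x z
  ly1 : ∀ x y z : g,
    br (br x y) z + br (br y z) x + br (br z x) y + tr x y z + tr y z x + tr z x y = 0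
  ly2 : ∀ x y z w : g, tr (br x y) z w + tr (br y z) x w + tr (br z x) y w = 0
  ly3 : ∀ x y z w : g, tr x y (br z w) = br (tr x y z) w + br z (tr x y w)
  ly4 : ∀ x y z w t : g,
    tr x y (tr z w t) = tr (tr x y z) w t + tr z (tr x y w) t + tr z w (tr x y t)

/-- the skew-symmetrization `[a,b] = a·b - b·a`,
`⟦a,b,c⟧ = {a,b,c} - {b,a,c} - ⦃c,a,b⦄ + ⦃c,b,a⦄` of an associative-Yamaguti algebra
is a Lie-Yamaguti algebra. -/
theorem assYamaguti_to_lieYamaguti {k A : Type*} [Field k] [CharZero k]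
    [AddCommGroup A] [Module k A]
    (mul : A →ₗ[k] A →ₗ[k] A) (tri tri' : A →ₗ[k] A →ₗ[k] A →ₗ[k] A)
    (hA : IsAssYamaguti mul tri tri') :
    ∃ (br : A →ₗ[k] A →ₗ[k] A) (lt : A →ₗ[k] A →ₗ[k] A →ₗ[k] A),
      (∀ a b : A, br a b = mul a b - mul b a) ∧
      (∀ a b c : A, lt a b c = tri a b c - tri b a c - tri' c a b + tri' c b a) ∧
      IsLieYamaguti br lt := by
  let br : A →ₗ[k] A →ₗ[k] A := mul - mul.flip
  let lt : A →ₗ[k] A →ₗ[k] A →ₗ[k] A :=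
    LinearMap.mk₂ k
      (fun a b => tri a b - tri b a - (tri'.flip a).flip b + (tri'.flip b).flip a)
      (fun a a' b => by ext c; simp; abel)
      (fun r a b => by ext c; simp [smul_sub, smul_add])
      (fun a b b' => by ext c; simp; abel)
      (fun r a b => by ext c; simp [smul_sub, smul_add])
  have hbr : ∀ a b : A, br a b = mul a b - mul b a := fun a b => by simp [br]
  have hlt : ∀ a b c : A, lt a b c = tri a b c - tri b a c - tri' c a b + tri' c b a :=
    fun a b c => by simp [lt]
  clear_value br lt
  refine ⟨br, lt, hbr, hlt, ?_, ?_, ?_, ?_, ?_, ?_⟩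
  · intro x y
    simp only [hbr]
    abel
  · intro x y z
    simp only [hlt]
    abel
  · intro x y z
    have assoc (a b c : A) : mul (mul a b) c = mul a (mul b c) - tri a b c + tri' a b c := by
      rw [← sub_eq_zero, ← hA.ay1 a b c]
      abel
    simp only [hbr, hlt, map_sub, LinearMap.sub_apply, assoc]
    abel
  · intro x y z w
    simp only [hbr, hlt, map_sub, LinearMap.sub_apply, hA.ay2, hA.ay5]
    abel
  · intro x y z w
    simp only [hbr, hlt, map_sub, map_add, LinearMap.sub_apply, LinearMap.add_apply,
      hA.ay3, hA.ay4, hA.ay6]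
    abel
  · intro x y z w t
    simp only [hlt, map_sub, map_add, LinearMap.sub_apply, LinearMap.add_apply,
      hA.ay7a, hA.ay7b, hA.ay8, hA.ay9a, hA.ay9b, hA.ay10, hA.ay11]
    abel
end

section
/- Let (A, { , , }) be an associative triple system, i.e. a vector space with a trilinear operation satisfying {{a,b,c},d,e} = {a,{b,c,d},e} = {a,b,{c,d,e}} for all a,b,c,d,e. Define ⟦a,b,c⟧ := {a,b,c} − {b,a,c} − {c,a,b} + {c,b,a}. Then (A, ⟦ , , ⟧) is a Lie triple system: ⟦a,b,c⟧ = −⟦b,a,c⟧, ⟦a,b,c⟧ + ⟦b,c,a⟧ + ⟦c,a,b⟧ = 0, and ⟦a,b,⟦c,d,e⟧⟧ = ⟦⟦a,b,c⟧,d,e⟧ + ⟦c,⟦a,b,d⟧,e⟧ + ⟦c,d,⟦a,b,e⟧⟧ for all a,b,c,d,e ∈ A. -/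
set_option maxHeartbeats 1000000

/-- an associative triple system yields a Lie triple system via
`⟦a,b,c⟧ := {a,b,c} - {b,a,c} - {c,a,b} + {c,b,a}`. -/
theorem ats_to_lieTripleSystem {k A : Type*} [Field k] [CharZero k]
    [AddCommGroup A] [Module k A]
    (T : A →ₗ[k] A →ₗ[k] A →ₗ[k] A)
    (h1 : ∀ a b c d e : A, T (T a b c) d e = T a (T b c d) e)
    (h2 : ∀ a b c d e : A, T a (T b c d) e = T a b (T c d e)) :
    ∃ L : A →ₗ[k] A →ₗ[k] A →ₗ[k] A,
      (∀ a b c : A, L a b c = T a b c - T b a c - T c a b + T c b a) ∧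
      (∀ a b c : A, L a b c = - L b a c) ∧
      (∀ a b c : A, L a b c + L b c a + L c a b = 0) ∧
      (∀ a b c d e : A,
        L a b (L c d e) = L (L a b c) d e + L c (L a b d) e + L c d (L a b e)) := by
  let P : A →ₗ[k] A →ₗ[k] A →ₗ[k] A := LinearMap.lflip.toLinearMap ∘ₗ T.flip
  have hL : ∀ a b c : A,
      (T - T.flip - P + P.flip) a b c = T a b c - T b a c - T c a b + T c b a :=
    fun _ _ _ => rfl
  refine ⟨T - T.flip - P + P.flip, hL, fun a b c => ?_, fun a b c => ?_, fun a b c d e => ?_⟩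
  · simp only [hL]
    abel
  · simp only [hL]
    abel
  · simp only [hL]
    simp only [map_add, map_sub, LinearMap.add_apply, LinearMap.sub_apply, ← h2, ← h1]
    abel
end

section
/- Let (D, ⊣, ⊢) be a diassociative algebra. Set a·b := a⊣b + a⊢b, {a,b,c} := −(a⊢b)⊢c, ⦃a,b,c⦄ := −(a⊣b)⊣c, and ⌊a,b⌋ := a⊢b − b⊣a. Then for all a,b,c ∈ D: (i) a·b − b·a = ⌊a,b⌋ − ⌊b,a⌋, and (ii) {a,b,c} − {b,a,c} − ⦃c,a,b⦄ + ⦃c,b,a⦄ = −⌊⌊a,b⌋,c⌋. In other words, the Lie-Yamaguti algebra obtained by skew-symmetrizing the associative-Yamaguti algebra of a diassociative algebra coincides with the Lie-Yamaguti algebra obtained from its associated Leibniz algebra via [x,y] := ⌊x,y⌋ − ⌊y,x⌋ and ⟦x,y,z⟧ := −⌊⌊x,y⌋,z⌋. -/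
set_option maxHeartbeats 1000000

/-- for a diassociative algebra, the skew-symmetrization of the induced
associative-Yamaguti algebra coincides with the Lie-Yamaguti algebra obtained from the
associated Leibniz bracket `⌊a,b⌋ = a⊢b - b⊣a`. -/
theorem diass_skew_symmetrization_compat {k D : Type*} [Field k] [CharZero k]
    [AddCommGroup D] [Module k D]
    (dl dr : D →ₗ[k] D →ₗ[k] D) (h : IsDiassociative dl dr) :
    ∀ a b c : D,
      ((dl a b + dr a b) - (dl b a + dr b a) =
        (dr a b - dl b a) - (dr b a - dl a b)) ∧
      ((-(dr (dr a b) c)) - (-(dr (dr b a) c)) - (-(dl (dl c a) b)) + (-(dl (dl c b) a)) =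
        -(dr (dr a b - dl b a) c - dl c (dr a b - dl b a))) := by
  intro a b c
  refine ⟨by abel, ?_⟩
  simp only [map_sub, LinearMap.sub_apply]
  rw [← h.di3 b a c, ← h.di1 c a b, h.assoc_l c a b, h.assoc_l c b a]
  abel
end

section
/- Let (A, ·, { , , }, ⦃ , , ⦄) be an associative-Yamaguti algebra and let M be a vector space equipped with bilinear maps · : A × M → M, · : M × A → M and trilinear maps { , , }, ⦃ , , ⦄ on A × A × M, A × M × A, M × A × A with values in M. Define on A ⊕ M: (a,u)·⋉(b,v) := (a·b, a·v + u·b); {(a,u),(b,v),(c,w)}⋉ := ({a,b,c}, {a,b,w} + {a,v,c} + {u,b,c}); ⦃(a,u),(b,v),(c,w)⦄⋉ := (⦃a,b,c⦄, ⦃a,b,w⦄ + ⦃a,v,c⦄ + ⦃u,b,c⦄). Then (A ⊕ M, ·⋉, { , , }⋉, ⦃ , , ⦄⋉) is an associative-Yamaguti algebra if and only if M with the given maps is a representation of A, i.e. the identities (AY1)–(AY11) hold whenever exactly one argument lies in M and the remaining arguments lie in A. -/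
set_option maxHeartbeats 1000000

/-- A representation of an associative-Yamaguti algebra `(A, mul, tri, tri')` on `M`:
actions `al : A × M → M` (`a·u`), `ar : M × A → M` (`u·a`) and trilinear actions
`t0,t1,t2` (for `{ , , }` with the `M`-slot in position 1,2,3) and `s0,s1,s2`
(for `⦃ , , ⦄`), satisfying the identities (AY1)-(AY11) whenever exactly one
argument lies in `M` and the remaining arguments lie in `A`. -/
structure IsAssYRep {k A M : Type*} [Field k] [AddCommGroup A] [Module k A]
    [AddCommGroup M] [Module k M]
    (mul : A →ₗ[k] A →ₗ[k] A) (tri tri' : A →ₗ[k] A →ₗ[k] A →ₗ[k] A)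
    (al : A →ₗ[k] M →ₗ[k] M) (ar : M →ₗ[k] A →ₗ[k] M)
    (t0 : M →ₗ[k] A →ₗ[k] A →ₗ[k] M) (t1 : A →ₗ[k] M →ₗ[k] A →ₗ[k] M)
    (t2 : A →ₗ[k] A →ₗ[k] M →ₗ[k] M)
    (s0 : M →ₗ[k] A →ₗ[k] A →ₗ[k] M) (s1 : A →ₗ[k] M →ₗ[k] A →ₗ[k] M)
    (s2 : A →ₗ[k] A →ₗ[k] M →ₗ[k] M) : Prop where
  ay1a : ∀ (u : M) (b c : A), ar (ar u b) c - ar u (mul b c) + t0 u b c - s0 u b c = 0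
  ay1b : ∀ (a : A) (v : M) (c : A), ar (al a v) c - al a (ar v c) + t1 a v c - s1 a v c = 0
  ay1c : ∀ (a b : A) (w : M), al (mul a b) w - al a (al b w) + t2 a b w - s2 a b w = 0
  ay2a : ∀ (u : M) (b c d : A), t0 (ar u b) c d = t0 u (mul b c) d
  ay2b : ∀ (a : A) (v : M) (c d : A), t0 (al a v) c d = t1 a (ar v c) d
  ay2c : ∀ (a b : A) (w : M) (d : A), t1 (mul a b) w d = t1 a (al b w) d
  ay2d : ∀ (a b c : A) (x : M), t2 (mul a b) c x = t2 a (mul b c) x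
  ay3a : ∀ (u : M) (b c d : A), t0 u b (mul c d) = ar (t0 u b c) d
  ay3b : ∀ (a : A) (v : M) (c d : A), t1 a v (mul c d) = ar (t1 a v c) d
  ay3c : ∀ (a b : A) (w : M) (d : A), t2 a b (ar w d) = ar (t2 a b w) d
  ay3d : ∀ (a b c : A) (x : M), t2 a b (al c x) = al (tri a b c) x
  ay4a : ∀ (u : M) (b c d : A), s0 (ar u b) c d = ar u (tri' b c d)
  ay4b : ∀ (a : A) (v : M) (c d : A), s0 (al a v) c d = al a (s0 v c d)
  ay4c : ∀ (a b : A) (w : M) (d : A), s1 (mul a b) w d = al a (s1 b w d)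
  ay4d : ∀ (a b c : A) (x : M), s2 (mul a b) c x = al a (s2 b c x)
  ay5a : ∀ (u : M) (b c d : A), s0 u (mul b c) d = s0 u b (mul c d)
  ay5b : ∀ (a : A) (v : M) (c d : A), s1 a (ar v c) d = s1 a v (mul c d)
  ay5c : ∀ (a b : A) (w : M) (d : A), s1 a (al b w) d = s2 a b (ar w d)
  ay5d : ∀ (a b c : A) (x : M), s2 a (mul b c) x = s2 a b (al c x)
  ay6a : ∀ (u : M) (b c d : A), ar u (tri b c d) = ar (s0 u b c) d
  ay6b : ∀ (a : A) (v : M) (c d : A), al a (t0 v c d) = ar (s1 a v c) d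
  ay6c : ∀ (a b : A) (w : M) (d : A), al a (t1 b w d) = ar (s2 a b w) d
  ay6d : ∀ (a b c : A) (x : M), al a (t2 b c x) = al (tri' a b c) x
  ay7a1 : ∀ (u : M) (b c d e : A), t0 (t0 u b c) d e = t0 u (tri' b c d) e
  ay7a2 : ∀ (u : M) (b c d e : A), t0 u (tri' b c d) e = t0 u b (tri c d e)
  ay7b1 : ∀ (a : A) (v : M) (c d e : A), t0 (t1 a v c) d e = t1 a (s0 v c d) e
  ay7b2 : ∀ (a : A) (v : M) (c d e : A), t1 a (s0 v c d) e = t1 a v (tri c d e)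
  ay7c1 : ∀ (a b : A) (w : M) (d e : A), t0 (t2 a b w) d e = t1 a (s1 b w d) e
  ay7c2 : ∀ (a b : A) (w : M) (d e : A), t1 a (s1 b w d) e = t2 a b (t0 w d e)
  ay7d1 : ∀ (a b c : A) (x : M) (e : A), t1 (tri a b c) x e = t1 a (s2 b c x) e
  ay7d2 : ∀ (a b c : A) (x : M) (e : A), t1 a (s2 b c x) e = t2 a b (t1 c x e)
  ay7e1 : ∀ (a b c d : A) (y : M), t2 (tri a b c) d y = t2 a (tri' b c d) y
  ay7e2 : ∀ (a b c d : A) (y : M), t2 a (tri' b c d) y = t2 a b (t2 c d y)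
  ay8a : ∀ (u : M) (b c d e : A), t0 u (tri b c d) e = t0 (s0 u b c) d e
  ay8b : ∀ (a : A) (v : M) (c d e : A), t1 a (t0 v c d) e = t0 (s1 a v c) d e
  ay8c : ∀ (a b : A) (w : M) (d e : A), t1 a (t1 b w d) e = t0 (s2 a b w) d e
  ay8d : ∀ (a b c : A) (x : M) (e : A), t1 a (t2 b c x) e = t1 (tri' a b c) x e
  ay8e : ∀ (a b c d : A) (y : M), t2 a (tri b c d) y = t2 (tri' a b c) d y
  ay9a1 : ∀ (u : M) (b c d e : A), s0 (s0 u b c) d e = s0 u (tri b c d) e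
  ay9a2 : ∀ (u : M) (b c d e : A), s0 u (tri b c d) e = s0 u b (tri' c d e)
  ay9b1 : ∀ (a : A) (v : M) (c d e : A), s0 (s1 a v c) d e = s1 a (t0 v c d) e
  ay9b2 : ∀ (a : A) (v : M) (c d e : A), s1 a (t0 v c d) e = s1 a v (tri' c d e)
  ay9c1 : ∀ (a b : A) (w : M) (d e : A), s0 (s2 a b w) d e = s1 a (t1 b w d) e
  ay9c2 : ∀ (a b : A) (w : M) (d e : A), s1 a (t1 b w d) e = s2 a b (s0 w d e)
  ay9d1 : ∀ (a b c : A) (x : M) (e : A), s1 (tri' a b c) x e = s1 a (t2 b c x) e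
  ay9d2 : ∀ (a b c : A) (x : M) (e : A), s1 a (t2 b c x) e = s2 a b (s1 c x e)
  ay9e1 : ∀ (a b c d : A) (y : M), s2 (tri' a b c) d y = s2 a (tri b c d) y
  ay9e2 : ∀ (a b c d : A) (y : M), s2 a (tri b c d) y = s2 a b (s2 c d y)
  ay10a : ∀ (u : M) (b c d e : A), s0 u (tri' b c d) e = s0 u b (tri c d e)
  ay10b : ∀ (a : A) (v : M) (c d e : A), s1 a (s0 v c d) e = s1 a v (tri c d e)
  ay10c : ∀ (a b : A) (w : M) (d e : A), s1 a (s1 b w d) e = s2 a b (t0 w d e)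
  ay10d : ∀ (a b c : A) (x : M) (e : A), s1 a (s2 b c x) e = s2 a b (t1 c x e)
  ay10e : ∀ (a b c d : A) (y : M), s2 a (tri' b c d) y = s2 a b (t2 c d y)
  ay11a : ∀ (u : M) (b c d e : A), t0 u b (tri' c d e) = s0 (t0 u b c) d e
  ay11b : ∀ (a : A) (v : M) (c d e : A), t1 a v (tri' c d e) = s0 (t1 a v c) d e
  ay11c : ∀ (a b : A) (w : M) (d e : A), t2 a b (s0 w d e) = s0 (t2 a b w) d e
  ay11d : ∀ (a b c : A) (x : M) (e : A), t2 a b (s1 c x e) = s1 (tri a b c) x e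
  ay11e : ∀ (a b c d : A) (y : M), t2 a b (s2 c d y) = s2 (tri a b c) d y

section Semidirect

variable {k A M : Type*} [Field k] [AddCommGroup A] [Module k A] [AddCommGroup M] [Module k M]

/-- The multiplication on `A × M` given by a multiplication on `A` and two actions on `M`. -/
def semidirectMul (mul : A →ₗ[k] A →ₗ[k] A) (al : A →ₗ[k] M →ₗ[k] M) (ar : M →ₗ[k] A →ₗ[k] M) :
    (A × M) →ₗ[k] (A × M) →ₗ[k] (A × M) :=
  (mul.compl₁₂ (.fst k A M) (.fst k A M)).compr₂ (.inl k A M) +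
    (al.compl₁₂ (.fst k A M) (.snd k A M) + ar.compl₁₂ (.snd k A M) (.fst k A M)).compr₂
      (.inr k A M)

/-- Precomposition of a trilinear map with a linear map in each variable, and postcomposition
with a linear map. -/
def trilinearComp {B C D N P Q : Type*} [AddCommGroup B] [Module k B] [AddCommGroup C] [Module k C]
    [AddCommGroup D] [Module k D] [AddCommGroup N] [Module k N] [AddCommGroup P] [Module k P]
    [AddCommGroup Q] [Module k Q] (t : B →ₗ[k] C →ₗ[k] D →ₗ[k] N)
    (f : P →ₗ[k] B) (g : P →ₗ[k] C) (h : P →ₗ[k] D) (j : N →ₗ[k] Q) :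
    P →ₗ[k] P →ₗ[k] P →ₗ[k] Q :=
  (t.compl₁₂ f g).compr₂ ((LinearMap.lcomp k Q h).comp (LinearMap.llcomp k D N Q j))

/-- The trilinear operation on `A × M` given by a trilinear operation on `A` and three trilinear
actions on `M`. -/
def semidirectTri (t : A →ₗ[k] A →ₗ[k] A →ₗ[k] A) (t0 : M →ₗ[k] A →ₗ[k] A →ₗ[k] M)
    (t1 : A →ₗ[k] M →ₗ[k] A →ₗ[k] M) (t2 : A →ₗ[k] A →ₗ[k] M →ₗ[k] M) :
    (A × M) →ₗ[k] (A × M) →ₗ[k] (A × M) →ₗ[k] (A × M) :=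
  trilinearComp t (.fst k A M) (.fst k A M) (.fst k A M) (.inl k A M) +
    (trilinearComp t2 (.fst k A M) (.fst k A M) (.snd k A M) (.inr k A M) +
      trilinearComp t1 (.fst k A M) (.snd k A M) (.fst k A M) (.inr k A M) +
      trilinearComp t0 (.snd k A M) (.fst k A M) (.fst k A M) (.inr k A M))

@[simp]
theorem semidirectMul_apply (mul : A →ₗ[k] A →ₗ[k] A) (al : A →ₗ[k] M →ₗ[k] M)
    (ar : M →ₗ[k] A →ₗ[k] M) (p q : A × M) :
    semidirectMul mul al ar p q = (mul p.1 q.1, al p.1 q.2 + ar p.2 q.1) := by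
  simp [semidirectMul]

@[simp]
theorem semidirectTri_apply (t : A →ₗ[k] A →ₗ[k] A →ₗ[k] A) (t0 : M →ₗ[k] A →ₗ[k] A →ₗ[k] M)
    (t1 : A →ₗ[k] M →ₗ[k] A →ₗ[k] M) (t2 : A →ₗ[k] A →ₗ[k] M →ₗ[k] M) (p q r : A × M) :
    semidirectTri t t0 t1 t2 p q r =
      (t p.1 q.1 r.1, t2 p.1 q.1 r.2 + t1 p.1 q.2 r.1 + t0 p.2 q.1 r.1) := by
  simp [semidirectTri, trilinearComp]

variable {mul : A →ₗ[k] A →ₗ[k] A} {tri tri' : A →ₗ[k] A →ₗ[k] A →ₗ[k] A}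
  {al : A →ₗ[k] M →ₗ[k] M} {ar : M →ₗ[k] A →ₗ[k] M}
  {t0 : M →ₗ[k] A →ₗ[k] A →ₗ[k] M} {t1 : A →ₗ[k] M →ₗ[k] A →ₗ[k] M}
  {t2 : A →ₗ[k] A →ₗ[k] M →ₗ[k] M}
  {s0 : M →ₗ[k] A →ₗ[k] A →ₗ[k] M} {s1 : A →ₗ[k] M →ₗ[k] A →ₗ[k] M}
  {s2 : A →ₗ[k] A →ₗ[k] M →ₗ[k] M}

theorem IsAssYRep.isAssYamaguti_semidirect (hA : IsAssYamaguti mul tri tri')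
    (h : IsAssYRep mul tri tri' al ar t0 t1 t2 s0 s1 s2) :
    IsAssYamaguti (semidirectMul mul al ar) (semidirectTri tri t0 t1 t2)
      (semidirectTri tri' s0 s1 s2) := by
  constructor <;>
    simp only [Prod.forall, semidirectMul_apply, semidirectTri_apply, map_add, LinearMap.add_apply,
      Prod.mk_sub_mk, Prod.mk_add_mk, Prod.mk_eq_zero, Prod.mk.injEq]
  case ay1 =>
    refine fun a u b v c w => ⟨hA.ay1 a b c, ?_⟩
    linear_combination (norm := abel)
      h.ay1a u b c + h.ay1b a v c + h.ay1c a b w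
  case ay2 =>
    refine fun a u b v c w d x => ⟨hA.ay2 a b c d, ?_⟩
    linear_combination (norm := abel)
      h.ay2a u b c d + h.ay2b a v c d + h.ay2c a b w d + h.ay2d a b c x
  case ay3 =>
    refine fun a u b v c w d x => ⟨hA.ay3 a b c d, ?_⟩
    linear_combination (norm := abel)
      h.ay3a u b c d + h.ay3b a v c d + h.ay3c a b w d + h.ay3d a b c x
  case ay4 =>
    refine fun a u b v c w d x => ⟨hA.ay4 a b c d, ?_⟩
    linear_combination (norm := abel)
      h.ay4a u b c d + h.ay4b a v c d + h.ay4c a b w d + h.ay4d a b c x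
  case ay5 =>
    refine fun a u b v c w d x => ⟨hA.ay5 a b c d, ?_⟩
    linear_combination (norm := abel)
      h.ay5a u b c d + h.ay5b a v c d + h.ay5c a b w d + h.ay5d a b c x
  case ay6 =>
    refine fun a u b v c w d x => ⟨hA.ay6 a b c d, ?_⟩
    linear_combination (norm := abel)
      h.ay6a u b c d + h.ay6b a v c d + h.ay6c a b w d + h.ay6d a b c x
  case ay7a =>
    refine fun a u b v c w d x e y => ⟨hA.ay7a a b c d e, ?_⟩
    linear_combination (norm := abel)
      h.ay7a1 u b c d e + h.ay7b1 a v c d e + h.ay7c1 a b w d e +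
      h.ay7d1 a b c x e + h.ay7e1 a b c d y
  case ay7b =>
    refine fun a u b v c w d x e y => ⟨hA.ay7b a b c d e, ?_⟩
    linear_combination (norm := abel)
      h.ay7a2 u b c d e + h.ay7b2 a v c d e + h.ay7c2 a b w d e +
      h.ay7d2 a b c x e + h.ay7e2 a b c d y
  case ay8 =>
    refine fun a u b v c w d x e y => ⟨hA.ay8 a b c d e, ?_⟩
    linear_combination (norm := abel)
      h.ay8a u b c d e + h.ay8b a v c d e + h.ay8c a b w d e +
      h.ay8d a b c x e + h.ay8e a b c d y
  case ay9a =>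
    refine fun a u b v c w d x e y => ⟨hA.ay9a a b c d e, ?_⟩
    linear_combination (norm := abel)
      h.ay9a1 u b c d e + h.ay9b1 a v c d e + h.ay9c1 a b w d e +
      h.ay9d1 a b c x e + h.ay9e1 a b c d y
  case ay9b =>
    refine fun a u b v c w d x e y => ⟨hA.ay9b a b c d e, ?_⟩
    linear_combination (norm := abel)
      h.ay9a2 u b c d e + h.ay9b2 a v c d e + h.ay9c2 a b w d e +
      h.ay9d2 a b c x e + h.ay9e2 a b c d y
  case ay10 =>
    refine fun a u b v c w d x e y => ⟨hA.ay10 a b c d e, ?_⟩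
    linear_combination (norm := abel)
      h.ay10a u b c d e + h.ay10b a v c d e + h.ay10c a b w d e +
      h.ay10d a b c x e + h.ay10e a b c d y
  case ay11 =>
    refine fun a u b v c w d x e y => ⟨hA.ay11 a b c d e, ?_⟩
    linear_combination (norm := abel)
      h.ay11a u b c d e + h.ay11b a v c d e + h.ay11c a b w d e +
      h.ay11d a b c x e + h.ay11e a b c d y

theorem IsAssYamaguti.isAssYRep_of_semidirect
    (h : IsAssYamaguti (semidirectMul mul al ar) (semidirectTri tri t0 t1 t2)
      (semidirectTri tri' s0 s1 s2)) :
    IsAssYRep mul tri tri' al ar t0 t1 t2 s0 s1 s2 where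
  ay1a u b c := by
    simpa using congrArg Prod.snd (h.ay1 (0, u) (b, 0) (c, 0))
  ay1b a v c := by
    simpa using congrArg Prod.snd (h.ay1 (a, 0) (0, v) (c, 0))
  ay1c a b w := by
    simpa using congrArg Prod.snd (h.ay1 (a, 0) (b, 0) (0, w))
  ay2a u b c d := by
    simpa using congrArg Prod.snd (h.ay2 (0, u) (b, 0) (c, 0) (d, 0))
  ay2b a v c d := by
    simpa using congrArg Prod.snd (h.ay2 (a, 0) (0, v) (c, 0) (d, 0))
  ay2c a b w d := by
    simpa using congrArg Prod.snd (h.ay2 (a, 0) (b, 0) (0, w) (d, 0))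
  ay2d a b c x := by
    simpa using congrArg Prod.snd (h.ay2 (a, 0) (b, 0) (c, 0) (0, x))
  ay3a u b c d := by
    simpa using congrArg Prod.snd (h.ay3 (0, u) (b, 0) (c, 0) (d, 0))
  ay3b a v c d := by
    simpa using congrArg Prod.snd (h.ay3 (a, 0) (0, v) (c, 0) (d, 0))
  ay3c a b w d := by
    simpa using congrArg Prod.snd (h.ay3 (a, 0) (b, 0) (0, w) (d, 0))
  ay3d a b c x := by
    simpa using congrArg Prod.snd (h.ay3 (a, 0) (b, 0) (c, 0) (0, x))
  ay4a u b c d := by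
    simpa using congrArg Prod.snd (h.ay4 (0, u) (b, 0) (c, 0) (d, 0))
  ay4b a v c d := by
    simpa using congrArg Prod.snd (h.ay4 (a, 0) (0, v) (c, 0) (d, 0))
  ay4c a b w d := by
    simpa using congrArg Prod.snd (h.ay4 (a, 0) (b, 0) (0, w) (d, 0))
  ay4d a b c x := by
    simpa using congrArg Prod.snd (h.ay4 (a, 0) (b, 0) (c, 0) (0, x))
  ay5a u b c d := by
    simpa using congrArg Prod.snd (h.ay5 (0, u) (b, 0) (c, 0) (d, 0))
  ay5b a v c d := by
    simpa using congrArg Prod.snd (h.ay5 (a, 0) (0, v) (c, 0) (d, 0))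
  ay5c a b w d := by
    simpa using congrArg Prod.snd (h.ay5 (a, 0) (b, 0) (0, w) (d, 0))
  ay5d a b c x := by
    simpa using congrArg Prod.snd (h.ay5 (a, 0) (b, 0) (c, 0) (0, x))
  ay6a u b c d := by
    simpa using congrArg Prod.snd (h.ay6 (0, u) (b, 0) (c, 0) (d, 0))
  ay6b a v c d := by
    simpa using congrArg Prod.snd (h.ay6 (a, 0) (0, v) (c, 0) (d, 0))
  ay6c a b w d := by
    simpa using congrArg Prod.snd (h.ay6 (a, 0) (b, 0) (0, w) (d, 0))
  ay6d a b c x := by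
    simpa using congrArg Prod.snd (h.ay6 (a, 0) (b, 0) (c, 0) (0, x))
  ay7a1 u b c d e := by
    simpa using congrArg Prod.snd (h.ay7a (0, u) (b, 0) (c, 0) (d, 0) (e, 0))
  ay7a2 u b c d e := by
    simpa using congrArg Prod.snd (h.ay7b (0, u) (b, 0) (c, 0) (d, 0) (e, 0))
  ay7b1 a v c d e := by
    simpa using congrArg Prod.snd (h.ay7a (a, 0) (0, v) (c, 0) (d, 0) (e, 0))
  ay7b2 a v c d e := by
    simpa using congrArg Prod.snd (h.ay7b (a, 0) (0, v) (c, 0) (d, 0) (e, 0))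
  ay7c1 a b w d e := by
    simpa using congrArg Prod.snd (h.ay7a (a, 0) (b, 0) (0, w) (d, 0) (e, 0))
  ay7c2 a b w d e := by
    simpa using congrArg Prod.snd (h.ay7b (a, 0) (b, 0) (0, w) (d, 0) (e, 0))
  ay7d1 a b c x e := by
    simpa using congrArg Prod.snd (h.ay7a (a, 0) (b, 0) (c, 0) (0, x) (e, 0))
  ay7d2 a b c x e := by
    simpa using congrArg Prod.snd (h.ay7b (a, 0) (b, 0) (c, 0) (0, x) (e, 0))
  ay7e1 a b c d y := by
    simpa using congrArg Prod.snd (h.ay7a (a, 0) (b, 0) (c, 0) (d, 0) (0, y))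
  ay7e2 a b c d y := by
    simpa using congrArg Prod.snd (h.ay7b (a, 0) (b, 0) (c, 0) (d, 0) (0, y))
  ay8a u b c d e := by
    simpa using congrArg Prod.snd (h.ay8 (0, u) (b, 0) (c, 0) (d, 0) (e, 0))
  ay8b a v c d e := by
    simpa using congrArg Prod.snd (h.ay8 (a, 0) (0, v) (c, 0) (d, 0) (e, 0))
  ay8c a b w d e := by
    simpa using congrArg Prod.snd (h.ay8 (a, 0) (b, 0) (0, w) (d, 0) (e, 0))
  ay8d a b c x e := by
    simpa using congrArg Prod.snd (h.ay8 (a, 0) (b, 0) (c, 0) (0, x) (e, 0))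
  ay8e a b c d y := by
    simpa using congrArg Prod.snd (h.ay8 (a, 0) (b, 0) (c, 0) (d, 0) (0, y))
  ay9a1 u b c d e := by
    simpa using congrArg Prod.snd (h.ay9a (0, u) (b, 0) (c, 0) (d, 0) (e, 0))
  ay9a2 u b c d e := by
    simpa using congrArg Prod.snd (h.ay9b (0, u) (b, 0) (c, 0) (d, 0) (e, 0))
  ay9b1 a v c d e := by
    simpa using congrArg Prod.snd (h.ay9a (a, 0) (0, v) (c, 0) (d, 0) (e, 0))
  ay9b2 a v c d e := by
    simpa using congrArg Prod.snd (h.ay9b (a, 0) (0, v) (c, 0) (d, 0) (e, 0))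
  ay9c1 a b w d e := by
    simpa using congrArg Prod.snd (h.ay9a (a, 0) (b, 0) (0, w) (d, 0) (e, 0))
  ay9c2 a b w d e := by
    simpa using congrArg Prod.snd (h.ay9b (a, 0) (b, 0) (0, w) (d, 0) (e, 0))
  ay9d1 a b c x e := by
    simpa using congrArg Prod.snd (h.ay9a (a, 0) (b, 0) (c, 0) (0, x) (e, 0))
  ay9d2 a b c x e := by
    simpa using congrArg Prod.snd (h.ay9b (a, 0) (b, 0) (c, 0) (0, x) (e, 0))
  ay9e1 a b c d y := by
    simpa using congrArg Prod.snd (h.ay9a (a, 0) (b, 0) (c, 0) (d, 0) (0, y))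
  ay9e2 a b c d y := by
    simpa using congrArg Prod.snd (h.ay9b (a, 0) (b, 0) (c, 0) (d, 0) (0, y))
  ay10a u b c d e := by
    simpa using congrArg Prod.snd (h.ay10 (0, u) (b, 0) (c, 0) (d, 0) (e, 0))
  ay10b a v c d e := by
    simpa using congrArg Prod.snd (h.ay10 (a, 0) (0, v) (c, 0) (d, 0) (e, 0))
  ay10c a b w d e := by
    simpa using congrArg Prod.snd (h.ay10 (a, 0) (b, 0) (0, w) (d, 0) (e, 0))
  ay10d a b c x e := by
    simpa using congrArg Prod.snd (h.ay10 (a, 0) (b, 0) (c, 0) (0, x) (e, 0))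
  ay10e a b c d y := by
    simpa using congrArg Prod.snd (h.ay10 (a, 0) (b, 0) (c, 0) (d, 0) (0, y))
  ay11a u b c d e := by
    simpa using congrArg Prod.snd (h.ay11 (0, u) (b, 0) (c, 0) (d, 0) (e, 0))
  ay11b a v c d e := by
    simpa using congrArg Prod.snd (h.ay11 (a, 0) (0, v) (c, 0) (d, 0) (e, 0))
  ay11c a b w d e := by
    simpa using congrArg Prod.snd (h.ay11 (a, 0) (b, 0) (0, w) (d, 0) (e, 0))
  ay11d a b c x e := by
    simpa using congrArg Prod.snd (h.ay11 (a, 0) (b, 0) (c, 0) (0, x) (e, 0))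
  ay11e a b c d y := by
    simpa using congrArg Prod.snd (h.ay11 (a, 0) (b, 0) (c, 0) (d, 0) (0, y))

end Semidirect

/-- the semidirect product operations on `A ⊕ M` form an
associative-Yamaguti algebra if and only if `M` with the given maps is a
representation of `(A, mul, tri, tri')`. -/
theorem semidirect_iff_rep {k A M : Type*} [Field k] [CharZero k]
    [AddCommGroup A] [Module k A] [AddCommGroup M] [Module k M]
    (mul : A →ₗ[k] A →ₗ[k] A) (tri tri' : A →ₗ[k] A →ₗ[k] A →ₗ[k] A)
    (hA : IsAssYamaguti mul tri tri')
    (al : A →ₗ[k] M →ₗ[k] M) (ar : M →ₗ[k] A →ₗ[k] M)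
    (t0 : M →ₗ[k] A →ₗ[k] A →ₗ[k] M) (t1 : A →ₗ[k] M →ₗ[k] A →ₗ[k] M)
    (t2 : A →ₗ[k] A →ₗ[k] M →ₗ[k] M)
    (s0 : M →ₗ[k] A →ₗ[k] A →ₗ[k] M) (s1 : A →ₗ[k] M →ₗ[k] A →ₗ[k] M)
    (s2 : A →ₗ[k] A →ₗ[k] M →ₗ[k] M) :
    ∃ (Mul : (A × M) →ₗ[k] (A × M) →ₗ[k] (A × M))
      (Tri Tri' : (A × M) →ₗ[k] (A × M) →ₗ[k] (A × M) →ₗ[k] (A × M)),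
      (∀ p q : A × M, Mul p q = (mul p.1 q.1, al p.1 q.2 + ar p.2 q.1)) ∧
      (∀ p q r : A × M,
        Tri p q r = (tri p.1 q.1 r.1, t2 p.1 q.1 r.2 + t1 p.1 q.2 r.1 + t0 p.2 q.1 r.1)) ∧
      (∀ p q r : A × M,
        Tri' p q r =
          (tri' p.1 q.1 r.1, s2 p.1 q.1 r.2 + s1 p.1 q.2 r.1 + s0 p.2 q.1 r.1)) ∧
      (IsAssYamaguti Mul Tri Tri' ↔
        IsAssYRep mul tri tri' al ar t0 t1 t2 s0 s1 s2) := by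
  exact ⟨semidirectMul mul al ar, semidirectTri tri t0 t1 t2, semidirectTri tri' s0 s1 s2,
    semidirectMul_apply mul al ar, semidirectTri_apply tri t0 t1 t2,
    semidirectTri_apply tri' s0 s1 s2,
    IsAssYamaguti.isAssYRep_of_semidirect, IsAssYRep.isAssYamaguti_semidirect hA⟩
end

section
/- Let (A, ·, { , , }, ⦃ , , ⦄) be an associative-Yamaguti algebra and (M, ·, { , , }, ⦃ , , ⦄) a representation of it. For any linear map f : A → M, the triple (μ_f, F_f, G_f) defined by μ_f(a,b) := f(a)·b + a·f(b) − f(a·b), F_f(a,b,c) := {f(a),b,c} + {a,f(b),c} + {a,b,f(c)} − f({a,b,c}), and G_f(a,b,c) := ⦃f(a),b,c⦄ + ⦃a,f(b),c⦄ + ⦃a,b,f(c)⦄ − f(⦃a,b,c⦄) is a (2,3)-cocycle of A with coefficients in M. -/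
set_option maxHeartbeats 1000000

/-- A (2,3)-cocycle of the associative-Yamaguti algebra `(A, mul, tri, tri')` with
coefficients in the representation `(M, al, ar, t0, t1, t2, s0, s1, s2)`. -/
structure Is23Cocycle {k A M : Type*} [Field k] [AddCommGroup A] [Module k A]
    [AddCommGroup M] [Module k M]
    (mul : A →ₗ[k] A →ₗ[k] A) (tri tri' : A →ₗ[k] A →ₗ[k] A →ₗ[k] A)
    (al : A →ₗ[k] M →ₗ[k] M) (ar : M →ₗ[k] A →ₗ[k] M)
    (t0 : M →ₗ[k] A →ₗ[k] A →ₗ[k] M) (t1 : A →ₗ[k] M →ₗ[k] A →ₗ[k] M)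
    (t2 : A →ₗ[k] A →ₗ[k] M →ₗ[k] M)
    (s0 : M →ₗ[k] A →ₗ[k] A →ₗ[k] M) (s1 : A →ₗ[k] M →ₗ[k] A →ₗ[k] M)
    (s2 : A →ₗ[k] A →ₗ[k] M →ₗ[k] M)
    (μ : A →ₗ[k] A →ₗ[k] M) (F G : A →ₗ[k] A →ₗ[k] A →ₗ[k] M) : Prop where
  co1 : ∀ a b c : A,
    ar (μ a b) c + μ (mul a b) c - al a (μ b c) - μ a (mul b c) + F a b c - G a b c = 0
  co2 : ∀ a b c d : A, t0 (μ a b) c d + F (mul a b) c d = t1 a (μ b c) d + F a (mul b c) d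
  co3 : ∀ a b c d : A, t2 a b (μ c d) + F a b (mul c d) = μ (tri a b c) d + ar (F a b c) d
  co4 : ∀ a b c d : A, s0 (μ a b) c d + G (mul a b) c d = μ a (tri' b c d) + al a (G b c d)
  co5 : ∀ a b c d : A, s1 a (μ b c) d + G a (mul b c) d = s2 a b (μ c d) + G a b (mul c d)
  co6 : ∀ a b c d : A, μ a (tri b c d) + al a (F b c d) = μ (tri' a b c) d + ar (G a b c) d
  co7a : ∀ a b c d e : A,
    t0 (F a b c) d e + F (tri a b c) d e = t1 a (G b c d) e + F a (tri' b c d) e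
  co7b : ∀ a b c d e : A,
    t1 a (G b c d) e + F a (tri' b c d) e = t2 a b (F c d e) + F a b (tri c d e)
  co8 : ∀ a b c d e : A,
    t1 a (F b c d) e + F a (tri b c d) e = t0 (G a b c) d e + F (tri' a b c) d e
  co9a : ∀ a b c d e : A,
    s0 (G a b c) d e + G (tri' a b c) d e = s1 a (F b c d) e + G a (tri b c d) e
  co9b : ∀ a b c d e : A,
    s1 a (F b c d) e + G a (tri b c d) e = s2 a b (G c d e) + G a b (tri' c d e)
  co10 : ∀ a b c d e : A,
    s1 a (G b c d) e + G a (tri' b c d) e = s2 a b (F c d e) + G a b (tri c d e)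
  co11 : ∀ a b c d e : A,
    t2 a b (G c d e) + F a b (tri' c d e) = s0 (F a b c) d e + G (tri a b c) d e

/-- for any linear map `f : A → M`, the coboundary triple
`(μ_f, F_f, G_f)` is a (2,3)-cocycle of the associative-Yamaguti algebra `A`
with coefficients in the representation `M`. -/
theorem coboundary_is_cocycle {k A M : Type*} [Field k] [CharZero k]
    [AddCommGroup A] [Module k A] [AddCommGroup M] [Module k M]
    (mul : A →ₗ[k] A →ₗ[k] A) (tri tri' : A →ₗ[k] A →ₗ[k] A →ₗ[k] A)
    (al : A →ₗ[k] M →ₗ[k] M) (ar : M →ₗ[k] A →ₗ[k] M)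
    (t0 : M →ₗ[k] A →ₗ[k] A →ₗ[k] M) (t1 : A →ₗ[k] M →ₗ[k] A →ₗ[k] M)
    (t2 : A →ₗ[k] A →ₗ[k] M →ₗ[k] M)
    (s0 : M →ₗ[k] A →ₗ[k] A →ₗ[k] M) (s1 : A →ₗ[k] M →ₗ[k] A →ₗ[k] M)
    (s2 : A →ₗ[k] A →ₗ[k] M →ₗ[k] M)
    (hA : IsAssYamaguti mul tri tri')
    (hM : IsAssYRep mul tri tri' al ar t0 t1 t2 s0 s1 s2)
    (f : A →ₗ[k] M) :
    ∃ (μ : A →ₗ[k] A →ₗ[k] M) (F G : A →ₗ[k] A →ₗ[k] A →ₗ[k] M),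
      (∀ a b : A, μ a b = ar (f a) b + al a (f b) - f (mul a b)) ∧
      (∀ a b c : A, F a b c = t0 (f a) b c + t1 a (f b) c + t2 a b (f c) - f (tri a b c)) ∧
      (∀ a b c : A,
        G a b c = s0 (f a) b c + s1 a (f b) c + s2 a b (f c) - f (tri' a b c)) ∧
      Is23Cocycle mul tri tri' al ar t0 t1 t2 s0 s1 s2 μ F G := by
  refine ⟨ar ∘ₗ f + (LinearMap.lcomp k M f) ∘ₗ al - mul.compr₂ f,
    t0 ∘ₗ f + (LinearMap.lcomp k (A →ₗ[k] M) f) ∘ₗ t1 + t2.compr₂ (LinearMap.lcomp k M f)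
      - tri.compr₂ (LinearMap.llcomp k A A M f),
    s0 ∘ₗ f + (LinearMap.lcomp k (A →ₗ[k] M) f) ∘ₗ s1 + s2.compr₂ (LinearMap.lcomp k M f)
      - tri'.compr₂ (LinearMap.llcomp k A A M f),
    fun _ _ => rfl, fun _ _ _ => rfl, fun _ _ _ => rfl, ?_⟩
  constructor <;> intros <;>
    simp only [LinearMap.add_apply, LinearMap.sub_apply, LinearMap.comp_apply,
      LinearMap.lcomp_apply, LinearMap.compr₂_apply, LinearMap.llcomp_apply, map_add, map_sub]
  case co1 a b c =>
    have h := congrArg f (hA.ay1 a b c)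
    simp only [map_add, map_sub, map_zero] at h
    linear_combination (norm := module)
      hM.ay1a (f a) b c +
      hM.ay1b a (f b) c +
      hM.ay1c a b (f c) - h
  case co2 a b c d =>
    have h := congrArg f (hA.ay2 a b c d)
    linear_combination (norm := module)
      hM.ay2a (f a) b c d +
      hM.ay2b a (f b) c d +
      hM.ay2c a b (f c) d +
      hM.ay2d a b c (f d) - h
  case co3 a b c d =>
    have h := congrArg f (hA.ay3 a b c d)
    linear_combination (norm := module)
      hM.ay3a (f a) b c d +
      hM.ay3b a (f b) c d +
      hM.ay3c a b (f c) d +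
      hM.ay3d a b c (f d) - h
  case co4 a b c d =>
    have h := congrArg f (hA.ay4 a b c d)
    linear_combination (norm := module)
      hM.ay4a (f a) b c d +
      hM.ay4b a (f b) c d +
      hM.ay4c a b (f c) d +
      hM.ay4d a b c (f d) - h
  case co5 a b c d =>
    have h := congrArg f (hA.ay5 a b c d)
    linear_combination (norm := module)
      hM.ay5a (f a) b c d +
      hM.ay5b a (f b) c d +
      hM.ay5c a b (f c) d +
      hM.ay5d a b c (f d) - h
  case co6 a b c d =>
    have h := congrArg f (hA.ay6 a b c d)
    linear_combination (norm := module)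
      hM.ay6a (f a) b c d +
      hM.ay6b a (f b) c d +
      hM.ay6c a b (f c) d +
      hM.ay6d a b c (f d) - h
  case co7a a b c d e =>
    have h := congrArg f (hA.ay7a a b c d e)
    linear_combination (norm := module)
      hM.ay7a1 (f a) b c d e +
      hM.ay7b1 a (f b) c d e +
      hM.ay7c1 a b (f c) d e +
      hM.ay7d1 a b c (f d) e +
      hM.ay7e1 a b c d (f e) - h
  case co7b a b c d e =>
    have h := congrArg f (hA.ay7b a b c d e)
    linear_combination (norm := module)
      hM.ay7a2 (f a) b c d e +
      hM.ay7b2 a (f b) c d e +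
      hM.ay7c2 a b (f c) d e +
      hM.ay7d2 a b c (f d) e +
      hM.ay7e2 a b c d (f e) - h
  case co8 a b c d e =>
    have h := congrArg f (hA.ay8 a b c d e)
    linear_combination (norm := module)
      hM.ay8a (f a) b c d e +
      hM.ay8b a (f b) c d e +
      hM.ay8c a b (f c) d e +
      hM.ay8d a b c (f d) e +
      hM.ay8e a b c d (f e) - h
  case co9a a b c d e =>
    have h := congrArg f (hA.ay9a a b c d e)
    linear_combination (norm := module)
      hM.ay9a1 (f a) b c d e +
      hM.ay9b1 a (f b) c d e +
      hM.ay9c1 a b (f c) d e +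
      hM.ay9d1 a b c (f d) e +
      hM.ay9e1 a b c d (f e) - h
  case co9b a b c d e =>
    have h := congrArg f (hA.ay9b a b c d e)
    linear_combination (norm := module)
      hM.ay9a2 (f a) b c d e +
      hM.ay9b2 a (f b) c d e +
      hM.ay9c2 a b (f c) d e +
      hM.ay9d2 a b c (f d) e +
      hM.ay9e2 a b c d (f e) - h
  case co10 a b c d e =>
    have h := congrArg f (hA.ay10 a b c d e)
    linear_combination (norm := module)
      hM.ay10a (f a) b c d e +
      hM.ay10b a (f b) c d e +
      hM.ay10c a b (f c) d e +
      hM.ay10d a b c (f d) e +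
      hM.ay10e a b c d (f e) - h
  case co11 a b c d e =>
    have h := congrArg f (hA.ay11 a b c d e)
    linear_combination (norm := module)
      hM.ay11a (f a) b c d e +
      hM.ay11b a (f b) c d e +
      hM.ay11c a b (f c) d e +
      hM.ay11d a b c (f d) e +
      hM.ay11e a b c d (f e) - h
end

section
/- Let (A, ·, { , , }, ⦃ , , ⦄) be an associative-Yamaguti algebra and (M, ·, { , , }, ⦃ , , ⦄) a representation of it. Given a bilinear map μ : A × A → M and trilinear maps F, G : A × A × A → M, define on A ⊕ M: (a,u)·⋉(b,v) := (a·b, a·v + u·b + μ(a,b)); {(a,u),(b,v),(c,w)}⋉ := ({a,b,c}, {a,b,w} + {a,v,c} + {u,b,c} + F(a,b,c)); ⦃(a,u),(b,v),(c,w)⦄⋉ := (⦃a,b,c⦄, ⦃a,b,w⦄ + ⦃a,v,c⦄ + ⦃u,b,c⦄ + G(a,b,c)). Then (μ, F, G) is a (2,3)-cocycle of A with coefficients in M if and only if (A ⊕ M, ·⋉, { , , }⋉, ⦃ , , ⦄⋉) is an associative-Yamaguti algebra. -/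
set_option maxHeartbeats 1000000

section TwistedSemidirect

variable {k A M : Type*} [Field k] [AddCommGroup A] [Module k A] [AddCommGroup M] [Module k M]

/-- The twisted semidirect product on `A × M` of a bilinear operation `f` on `A`, given its
actions `g₀`, `g₁` on `M` (the index is the position of the `M`-slot) and a twist `c`. -/
def twistedBilin (f : A →ₗ[k] A →ₗ[k] A) (g₀ : M →ₗ[k] A →ₗ[k] M) (g₁ : A →ₗ[k] M →ₗ[k] M)
    (c : A →ₗ[k] A →ₗ[k] M) : (A × M) →ₗ[k] (A × M) →ₗ[k] (A × M) :=
  LinearMap.mk₂ k (fun p q => (f p.1 q.1, g₁ p.1 q.2 + g₀ p.2 q.1 + c p.1 q.1))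
    (fun p p' q => by ext <;> simp; abel)
    (fun r p q => by ext <;> simp)
    (fun p q q' => by ext <;> simp; abel)
    (fun r p q => by ext <;> simp)

@[simp]
lemma twistedBilin_apply (f : A →ₗ[k] A →ₗ[k] A) (g₀ : M →ₗ[k] A →ₗ[k] M)
    (g₁ : A →ₗ[k] M →ₗ[k] M) (c : A →ₗ[k] A →ₗ[k] M) (p q : A × M) :
    twistedBilin f g₀ g₁ c p q = (f p.1 q.1, g₁ p.1 q.2 + g₀ p.2 q.1 + c p.1 q.1) := rfl

/-- The twisted semidirect product on `A × M` of a trilinear operation `f` on `A`, given its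
actions `g₀`, `g₁`, `g₂` on `M` (the index is the position of the `M`-slot) and a twist `c`. -/
def twistedTrilin (f : A →ₗ[k] A →ₗ[k] A →ₗ[k] A) (g₀ : M →ₗ[k] A →ₗ[k] A →ₗ[k] M)
    (g₁ : A →ₗ[k] M →ₗ[k] A →ₗ[k] M) (g₂ : A →ₗ[k] A →ₗ[k] M →ₗ[k] M)
    (c : A →ₗ[k] A →ₗ[k] A →ₗ[k] M) :
    (A × M) →ₗ[k] (A × M) →ₗ[k] (A × M) →ₗ[k] (A × M) :=
  LinearMap.mk₂ k
    (fun p q => LinearMap.prod (f p.1 q.1 ∘ₗ LinearMap.fst k A M)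
      (g₂ p.1 q.1 ∘ₗ LinearMap.snd k A M +
        (g₁ p.1 q.2 + g₀ p.2 q.1 + c p.1 q.1) ∘ₗ LinearMap.fst k A M))
    (fun p p' q => by ext <;> simp; abel)
    (fun r p q => by ext <;> simp)
    (fun p q q' => by ext <;> simp; abel)
    (fun r p q => by ext <;> simp)

@[simp]
lemma twistedTrilin_apply (f : A →ₗ[k] A →ₗ[k] A →ₗ[k] A) (g₀ : M →ₗ[k] A →ₗ[k] A →ₗ[k] M)
    (g₁ : A →ₗ[k] M →ₗ[k] A →ₗ[k] M) (g₂ : A →ₗ[k] A →ₗ[k] M →ₗ[k] M)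
    (c : A →ₗ[k] A →ₗ[k] A →ₗ[k] M) (p q r : A × M) :
    twistedTrilin f g₀ g₁ g₂ c p q r = (f p.1 q.1 r.1,
      g₂ p.1 q.1 r.2 + g₁ p.1 q.2 r.1 + g₀ p.2 q.1 r.1 + c p.1 q.1 r.1) := by
  simp [twistedTrilin, add_assoc]

end TwistedSemidirect

/-- `(μ, F, G)` is a (2,3)-cocycle of `A` with coefficients in the
representation `M` if and only if the twisted semidirect product operations make
`A ⊕ M` an associative-Yamaguti algebra. -/
theorem cocycle_iff_twisted_semidirect {k A M : Type*} [Field k] [CharZero k]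
    [AddCommGroup A] [Module k A] [AddCommGroup M] [Module k M]
    (mul : A →ₗ[k] A →ₗ[k] A) (tri tri' : A →ₗ[k] A →ₗ[k] A →ₗ[k] A)
    (al : A →ₗ[k] M →ₗ[k] M) (ar : M →ₗ[k] A →ₗ[k] M)
    (t0 : M →ₗ[k] A →ₗ[k] A →ₗ[k] M) (t1 : A →ₗ[k] M →ₗ[k] A →ₗ[k] M)
    (t2 : A →ₗ[k] A →ₗ[k] M →ₗ[k] M)
    (s0 : M →ₗ[k] A →ₗ[k] A →ₗ[k] M) (s1 : A →ₗ[k] M →ₗ[k] A →ₗ[k] M)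
    (s2 : A →ₗ[k] A →ₗ[k] M →ₗ[k] M)
    (hA : IsAssYamaguti mul tri tri')
    (hM : IsAssYRep mul tri tri' al ar t0 t1 t2 s0 s1 s2)
    (μ : A →ₗ[k] A →ₗ[k] M) (F G : A →ₗ[k] A →ₗ[k] A →ₗ[k] M) :
    ∃ (Mul : (A × M) →ₗ[k] (A × M) →ₗ[k] (A × M))
      (Tri Tri' : (A × M) →ₗ[k] (A × M) →ₗ[k] (A × M) →ₗ[k] (A × M)),
      (∀ p q : A × M,
        Mul p q = (mul p.1 q.1, al p.1 q.2 + ar p.2 q.1 + μ p.1 q.1)) ∧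
      (∀ p q r : A × M,
        Tri p q r = (tri p.1 q.1 r.1,
          t2 p.1 q.1 r.2 + t1 p.1 q.2 r.1 + t0 p.2 q.1 r.1 + F p.1 q.1 r.1)) ∧
      (∀ p q r : A × M,
        Tri' p q r = (tri' p.1 q.1 r.1,
          s2 p.1 q.1 r.2 + s1 p.1 q.2 r.1 + s0 p.2 q.1 r.1 + G p.1 q.1 r.1)) ∧
      (Is23Cocycle mul tri tri' al ar t0 t1 t2 s0 s1 s2 μ F G ↔
        IsAssYamaguti Mul Tri Tri') := by
  refine ⟨twistedBilin mul ar al μ, twistedTrilin tri t0 t1 t2 F, twistedTrilin tri' s0 s1 s2 G,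
    fun _ _ => rfl, twistedTrilin_apply _ _ _ _ _, twistedTrilin_apply _ _ _ _ _,
    fun h => ?_, fun h => ?_⟩
  · constructor
    · rintro ⟨a, u⟩ ⟨b, v⟩ ⟨c, w⟩
      ext
      · simpa using hA.ay1 a b c
      · simp only [twistedBilin_apply, twistedTrilin_apply, map_add, LinearMap.add_apply,
          Prod.snd_add, Prod.snd_sub, Prod.snd_zero]
        linear_combination (norm := abel) h.co1 a b c + hM.ay1a u b c + hM.ay1b a v c +
          hM.ay1c a b w
    · rintro ⟨a, u⟩ ⟨b, v⟩ ⟨c, w⟩ ⟨d, x⟩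
      ext
      · simpa using hA.ay2 a b c d
      · simp only [twistedBilin_apply, twistedTrilin_apply, map_add, LinearMap.add_apply]
        linear_combination (norm := abel) h.co2 a b c d + hM.ay2a u b c d + hM.ay2b a v c d +
          hM.ay2c a b w d + hM.ay2d a b c x
    · rintro ⟨a, u⟩ ⟨b, v⟩ ⟨c, w⟩ ⟨d, x⟩
      ext
      · simpa using hA.ay3 a b c d
      · simp only [twistedBilin_apply, twistedTrilin_apply, map_add, LinearMap.add_apply]
        linear_combination (norm := abel) h.co3 a b c d + hM.ay3a u b c d + hM.ay3b a v c d +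
          hM.ay3c a b w d + hM.ay3d a b c x
    · rintro ⟨a, u⟩ ⟨b, v⟩ ⟨c, w⟩ ⟨d, x⟩
      ext
      · simpa using hA.ay4 a b c d
      · simp only [twistedBilin_apply, twistedTrilin_apply, map_add, LinearMap.add_apply]
        linear_combination (norm := abel) h.co4 a b c d + hM.ay4a u b c d + hM.ay4b a v c d +
          hM.ay4c a b w d + hM.ay4d a b c x
    · rintro ⟨a, u⟩ ⟨b, v⟩ ⟨c, w⟩ ⟨d, x⟩
      ext
      · simpa using hA.ay5 a b c d
      · simp only [twistedBilin_apply, twistedTrilin_apply, map_add, LinearMap.add_apply]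
        linear_combination (norm := abel) h.co5 a b c d + hM.ay5a u b c d + hM.ay5b a v c d +
          hM.ay5c a b w d + hM.ay5d a b c x
    · rintro ⟨a, u⟩ ⟨b, v⟩ ⟨c, w⟩ ⟨d, x⟩
      ext
      · simpa using hA.ay6 a b c d
      · simp only [twistedBilin_apply, twistedTrilin_apply, map_add, LinearMap.add_apply]
        linear_combination (norm := abel) h.co6 a b c d + hM.ay6a u b c d + hM.ay6b a v c d +
          hM.ay6c a b w d + hM.ay6d a b c x
    · rintro ⟨a, u⟩ ⟨b, v⟩ ⟨c, w⟩ ⟨d, x⟩ ⟨e, y⟩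
      ext
      · simpa using hA.ay7a a b c d e
      · simp only [twistedTrilin_apply, map_add, LinearMap.add_apply]
        linear_combination (norm := abel) h.co7a a b c d e + hM.ay7a1 u b c d e +
          hM.ay7b1 a v c d e + hM.ay7c1 a b w d e + hM.ay7d1 a b c x e + hM.ay7e1 a b c d y
    · rintro ⟨a, u⟩ ⟨b, v⟩ ⟨c, w⟩ ⟨d, x⟩ ⟨e, y⟩
      ext
      · simpa using hA.ay7b a b c d e
      · simp only [twistedTrilin_apply, map_add, LinearMap.add_apply]
        linear_combination (norm := abel) h.co7b a b c d e + hM.ay7a2 u b c d e +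
          hM.ay7b2 a v c d e + hM.ay7c2 a b w d e + hM.ay7d2 a b c x e + hM.ay7e2 a b c d y
    · rintro ⟨a, u⟩ ⟨b, v⟩ ⟨c, w⟩ ⟨d, x⟩ ⟨e, y⟩
      ext
      · simpa using hA.ay8 a b c d e
      · simp only [twistedTrilin_apply, map_add, LinearMap.add_apply]
        linear_combination (norm := abel) h.co8 a b c d e + hM.ay8a u b c d e +
          hM.ay8b a v c d e + hM.ay8c a b w d e + hM.ay8d a b c x e + hM.ay8e a b c d y
    · rintro ⟨a, u⟩ ⟨b, v⟩ ⟨c, w⟩ ⟨d, x⟩ ⟨e, y⟩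
      ext
      · simpa using hA.ay9a a b c d e
      · simp only [twistedTrilin_apply, map_add, LinearMap.add_apply]
        linear_combination (norm := abel) h.co9a a b c d e + hM.ay9a1 u b c d e +
          hM.ay9b1 a v c d e + hM.ay9c1 a b w d e + hM.ay9d1 a b c x e + hM.ay9e1 a b c d y
    · rintro ⟨a, u⟩ ⟨b, v⟩ ⟨c, w⟩ ⟨d, x⟩ ⟨e, y⟩
      ext
      · simpa using hA.ay9b a b c d e
      · simp only [twistedTrilin_apply, map_add, LinearMap.add_apply]
        linear_combination (norm := abel) h.co9b a b c d e + hM.ay9a2 u b c d e +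
          hM.ay9b2 a v c d e + hM.ay9c2 a b w d e + hM.ay9d2 a b c x e + hM.ay9e2 a b c d y
    · rintro ⟨a, u⟩ ⟨b, v⟩ ⟨c, w⟩ ⟨d, x⟩ ⟨e, y⟩
      ext
      · simpa using hA.ay10 a b c d e
      · simp only [twistedTrilin_apply, map_add, LinearMap.add_apply]
        linear_combination (norm := abel) h.co10 a b c d e + hM.ay10a u b c d e +
          hM.ay10b a v c d e + hM.ay10c a b w d e + hM.ay10d a b c x e + hM.ay10e a b c d y
    · rintro ⟨a, u⟩ ⟨b, v⟩ ⟨c, w⟩ ⟨d, x⟩ ⟨e, y⟩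
      ext
      · simpa using hA.ay11 a b c d e
      · simp only [twistedTrilin_apply, map_add, LinearMap.add_apply]
        linear_combination (norm := abel) h.co11 a b c d e + hM.ay11a u b c d e +
          hM.ay11b a v c d e + hM.ay11c a b w d e + hM.ay11d a b c x e + hM.ay11e a b c d y
  · constructor
    · intro a b c
      have := congrArg Prod.snd (h.ay1 (a, 0) (b, 0) (c, 0))
      simp only [twistedBilin_apply, twistedTrilin_apply, map_zero, LinearMap.zero_apply, zero_add,
        Prod.snd_add, Prod.snd_sub, Prod.snd_zero] at this
      linear_combination (norm := abel) this
    · intro a b c d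
      simpa using congrArg Prod.snd (h.ay2 (a, 0) (b, 0) (c, 0) (d, 0))
    · intro a b c d
      simpa [add_comm] using congrArg Prod.snd (h.ay3 (a, 0) (b, 0) (c, 0) (d, 0))
    · intro a b c d
      simpa [add_comm] using congrArg Prod.snd (h.ay4 (a, 0) (b, 0) (c, 0) (d, 0))
    · intro a b c d
      simpa using congrArg Prod.snd (h.ay5 (a, 0) (b, 0) (c, 0) (d, 0))
    · intro a b c d
      simpa [add_comm] using congrArg Prod.snd (h.ay6 (a, 0) (b, 0) (c, 0) (d, 0))
    · intro a b c d e
      simpa using congrArg Prod.snd (h.ay7a (a, 0) (b, 0) (c, 0) (d, 0) (e, 0))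
    · intro a b c d e
      simpa using congrArg Prod.snd (h.ay7b (a, 0) (b, 0) (c, 0) (d, 0) (e, 0))
    · intro a b c d e
      simpa using congrArg Prod.snd (h.ay8 (a, 0) (b, 0) (c, 0) (d, 0) (e, 0))
    · intro a b c d e
      simpa using congrArg Prod.snd (h.ay9a (a, 0) (b, 0) (c, 0) (d, 0) (e, 0))
    · intro a b c d e
      simpa using congrArg Prod.snd (h.ay9b (a, 0) (b, 0) (c, 0) (d, 0) (e, 0))
    · intro a b c d e
      simpa using congrArg Prod.snd (h.ay10 (a, 0) (b, 0) (c, 0) (d, 0) (e, 0))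
    · intro a b c d e
      simpa using congrArg Prod.snd (h.ay11 (a, 0) (b, 0) (c, 0) (d, 0) (e, 0))
end

section
/- Let A be a vector space over a field k of characteristic 0 with trilinear operations { , , } and ⦃ , , ⦄ forming a weak associative triple system, i.e. satisfying only the identities (AY7) {{a,b,c},d,e} = {a,⦃b,c,d⦄,e} = {a,b,{c,d,e}} and (AY9) ⦃⦃a,b,c⦄,d,e⦄ = ⦃a,{b,c,d},e⦄ = ⦃a,b,⦃c,d,e⦄⦄ for all a,b,c,d,e ∈ A. Define on the tensor product A ⊗ A the bilinear operations determined by (a⊗b) ⊣ (c⊗d) := a ⊗ {b,c,d} and (a⊗b) ⊢ (c⊗d) := ⦃a,b,c⦄ ⊗ d. Then (A ⊗ A, ⊣, ⊢) is a diassociative algebra: ⊣ and ⊢ are associative and satisfy x⊣(y⊣z) = x⊣(y⊢z), (x⊢y)⊣z = x⊢(y⊣z), and (x⊢y)⊢z = (x⊣y)⊢z for all x,y,z ∈ A ⊗ A. -/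
set_option maxHeartbeats 1000000

open TensorProduct

/-- Trilinear maps on `A ⊗ A` that agree on all triples of pure tensors are equal. -/
theorem TensorProduct.eq_of_forall_pure_triple {k A M : Type*} [Field k]
    [AddCommGroup A] [Module k A] [AddCommGroup M] [Module k M]
    {f g : (A ⊗[k] A) →ₗ[k] (A ⊗[k] A) →ₗ[k] (A ⊗[k] A) →ₗ[k] M}
    (h : ∀ a b c d e e' : A, f (a ⊗ₜ b) (c ⊗ₜ d) (e ⊗ₜ e') = g (a ⊗ₜ b) (c ⊗ₜ d) (e ⊗ₜ e')) :
    ∀ x y z, f x y z = g x y z := by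
  intro x y z
  induction x with
  | zero => simp
  | add x x' hx hx' => simp only [map_add, LinearMap.add_apply, hx, hx']
  | tmul a b =>
    induction y with
    | zero => simp
    | add y y' hy hy' => simp only [map_add, LinearMap.add_apply, hy, hy']
    | tmul c d =>
      induction z with
      | zero => simp
      | add z z' hz hz' => simp only [map_add, hz, hz']
      | tmul e e' => exact h a b c d e e'

/-- Mixed associativity-type identities `p (q x y) z = r x (s y z)` may be checked on pure tensors. -/
theorem TensorProduct.mixed_assoc_of_pure {k A : Type*} [Field k] [AddCommGroup A] [Module k A]
    (p q r s : (A ⊗[k] A) →ₗ[k] (A ⊗[k] A) →ₗ[k] (A ⊗[k] A))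
    (h : ∀ a b c d e e' : A, p (q (a ⊗ₜ b) (c ⊗ₜ d)) (e ⊗ₜ e') =
      r (a ⊗ₜ b) (s (c ⊗ₜ d) (e ⊗ₜ e'))) :
    ∀ x y z, p (q x y) z = r x (s y z) :=
  eq_of_forall_pure_triple (f := q.compr₂ p)
    (g := ((LinearMap.llcomp k _ _ _).flip s) ∘ₗ LinearMap.llcomp k _ _ _ ∘ₗ r) h

/-- a weak associative triple system `(A, { , , }, ⦃ , , ⦄)`
(satisfying (AY7) and (AY9)) yields a diassociative algebra structure on `A ⊗ A` via
`(a⊗b) ⊣ (c⊗d) = a ⊗ {b,c,d}` and `(a⊗b) ⊢ (c⊗d) = ⦃a,b,c⦄ ⊗ d`. -/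
theorem weak_ats_to_diassociative {k A : Type*} [Field k] [CharZero k]
    [AddCommGroup A] [Module k A]
    (tri tri' : A →ₗ[k] A →ₗ[k] A →ₗ[k] A)
    (ay7a : ∀ a b c d e : A, tri (tri a b c) d e = tri a (tri' b c d) e)
    (ay7b : ∀ a b c d e : A, tri a (tri' b c d) e = tri a b (tri c d e))
    (ay9a : ∀ a b c d e : A, tri' (tri' a b c) d e = tri' a (tri b c d) e)
    (ay9b : ∀ a b c d e : A, tri' a (tri b c d) e = tri' a b (tri' c d e)) :
    ∃ dl dr : (A ⊗[k] A) →ₗ[k] (A ⊗[k] A) →ₗ[k] (A ⊗[k] A),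
      (∀ a b c d : A, dl (a ⊗ₜ[k] b) (c ⊗ₜ[k] d) = a ⊗ₜ[k] tri b c d) ∧
      (∀ a b c d : A, dr (a ⊗ₜ[k] b) (c ⊗ₜ[k] d) = tri' a b c ⊗ₜ[k] d) ∧
      IsDiassociative dl dr := by
  let dl : (A ⊗[k] A) →ₗ[k] (A ⊗[k] A) →ₗ[k] (A ⊗[k] A) :=
    TensorProduct.lift (LinearMap.mk₂ k (fun a b => TensorProduct.mk k A A a ∘ₗ TensorProduct.lift (tri b))
      (by intros; ext; simp) (by intros; ext; simp [smul_tmul'])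
      (by intros; ext; simp [tmul_add]) (by intros; ext; simp))
  let dr : (A ⊗[k] A) →ₗ[k] (A ⊗[k] A) →ₗ[k] (A ⊗[k] A) :=
    TensorProduct.lift (tri'.compr₂ (LinearMap.rTensorHom A))
  have hl : ∀ a b c d : A, dl (a ⊗ₜ[k] b) (c ⊗ₜ[k] d) = a ⊗ₜ[k] tri b c d := by simp [dl]
  have hr : ∀ a b c d : A, dr (a ⊗ₜ[k] b) (c ⊗ₜ[k] d) = tri' a b c ⊗ₜ[k] d := by simp [dr]
  have assoc_l : ∀ x y z, dl (dl x y) z = dl x (dl y z) :=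
    TensorProduct.mixed_assoc_of_pure dl dl dl dl fun _ _ _ _ _ _ => by simp only [hl, ay7a, ay7b]
  have assoc_r : ∀ x y z, dr (dr x y) z = dr x (dr y z) :=
    TensorProduct.mixed_assoc_of_pure dr dr dr dr fun _ _ _ _ _ _ => by simp only [hr, ay9a, ay9b]
  refine ⟨dl, dr, hl, hr, assoc_l, assoc_r, fun x y z => ?_, ?_, fun x y z => ?_⟩
  · rw [← assoc_l]
    exact TensorProduct.mixed_assoc_of_pure dl dl dl dr (fun _ _ _ _ _ _ => by simp only [hl, hr, ay7a]) x y z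
  · exact TensorProduct.mixed_assoc_of_pure dl dr dr dl fun _ _ _ _ _ _ => by simp only [hl, hr]
  · rw [assoc_r]
    exact (TensorProduct.mixed_assoc_of_pure dr dl dr dr
      (fun _ _ _ _ _ _ => by simp only [hl, hr, ay9b]) x y z).symm
end

section
/- Let (A, ·) be an associative algebra and M a bimodule over A. Define on A ⊕ M: (a,u) • (b,v) := (2 a·b, a·v + u·b); {(a,u),(b,v),(c,w)} := −(a·b·c, a·b·w); ⦃(a,u),(b,v),(c,w)⦄ := −(a·b·c, u·b·c). Then (A ⊕ M, •, { , , }, ⦃ , , ⦄) is an associative-Yamaguti algebra, i.e. the identities (AY1)–(AY11) hold. -/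
set_option maxHeartbeats 1000000

/-- The product `(a,u) (b,v) = (a·b, a·v)` on `A × M` given by a left action of `A` on `M`. -/
def leftProd {k A M : Type*} [Field k] [AddCommGroup A] [Module k A] [AddCommGroup M]
    [Module k M] (m : A →ₗ[k] A →ₗ[k] A) (al : A →ₗ[k] M →ₗ[k] M) :
    (A × M) →ₗ[k] (A × M) →ₗ[k] (A × M) :=
  LinearMap.mk₂ k (fun p q => (m p.1 q.1, al p.1 q.2))
    (by intros; simp) (by intros; simp) (by intros; simp) (by intros; simp)

/-- The product `(a,u) (b,v) = (a·b, u·b)` on `A × M` given by a right action of `A` on `M`. -/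
def rightProd {k A M : Type*} [Field k] [AddCommGroup A] [Module k A] [AddCommGroup M]
    [Module k M] (m : A →ₗ[k] A →ₗ[k] A) (ar : M →ₗ[k] A →ₗ[k] M) :
    (A × M) →ₗ[k] (A × M) →ₗ[k] (A × M) :=
  LinearMap.mk₂ k (fun p q => (m p.1 q.1, ar p.2 q.1))
    (by intros; simp) (by intros; simp) (by intros; simp) (by intros; simp)

/-- for an associative algebra `(A, m)` and a bimodule `M` over it,
the operations `(a,u) • (b,v) = (2 a·b, a·v + u·b)`,
`{(a,u),(b,v),(c,w)} = -(a·b·c, a·b·w)` and `⦃(a,u),(b,v),(c,w)⦄ = -(a·b·c, u·b·c)`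
make `A ⊕ M` an associative-Yamaguti algebra. -/
theorem bimodule_to_assYamaguti {k A M : Type*} [Field k] [CharZero k]
    [AddCommGroup A] [Module k A] [AddCommGroup M] [Module k M]
    (m : A →ₗ[k] A →ₗ[k] A)
    (hassoc : ∀ a b c : A, m (m a b) c = m a (m b c))
    (al : A →ₗ[k] M →ₗ[k] M) (ar : M →ₗ[k] A →ₗ[k] M)
    (h1 : ∀ (a b : A) (u : M), al (m a b) u = al a (al b u))
    (h2 : ∀ (u : M) (a b : A), ar u (m a b) = ar (ar u a) b)
    (h3 : ∀ (a : A) (u : M) (b : A), ar (al a u) b = al a (ar u b)) :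
    ∃ (Mul : (A × M) →ₗ[k] (A × M) →ₗ[k] (A × M))
      (Tri Tri' : (A × M) →ₗ[k] (A × M) →ₗ[k] (A × M) →ₗ[k] (A × M)),
      (∀ p q : A × M, Mul p q = ((2 : k) • m p.1 q.1, al p.1 q.2 + ar p.2 q.1)) ∧
      (∀ p q r : A × M, Tri p q r = (-(m (m p.1 q.1) r.1), -(al (m p.1 q.1) r.2))) ∧
      (∀ p q r : A × M, Tri' p q r = (-(m (m p.1 q.1) r.1), -(ar (ar p.2 q.1) r.1))) ∧
      IsAssYamaguti Mul Tri Tri' := by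
  refine ⟨leftProd m al + rightProd m ar, (leftProd m al).compr₂ (-leftProd m al),
    (rightProd m ar).compr₂ (-rightProd m ar), ?_⟩
  have hMul : ∀ p q : A × M, (leftProd m al + rightProd m ar) p q
      = ((2 : k) • m p.1 q.1, al p.1 q.2 + ar p.2 q.1) := fun p q => by
    simp [leftProd, rightProd, two_smul]
  have hTri : ∀ p q r : A × M, ((leftProd m al).compr₂ (-leftProd m al)) p q r
      = (-(m (m p.1 q.1) r.1), -(al (m p.1 q.1) r.2)) := fun p q r => by
    simp [leftProd]
  have hTri' : ∀ p q r : A × M, ((rightProd m ar).compr₂ (-rightProd m ar)) p q r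
      = (-(m (m p.1 q.1) r.1), -(ar (ar p.2 q.1) r.1)) := fun p q r => by
    simp [rightProd]
  refine ⟨hMul, hTri, hTri', ?_⟩
  constructor <;> intros <;> simp only [hMul, hTri, hTri'] <;> ext <;>
    simp [hassoc, h1, h2, h3, two_smul] <;> abel
end

section
/- Let (A, ·, { , , }, ⦃ , , ⦄) be an associative-Yamaguti algebra, (M, ·, { , , }, ⦃ , , ⦄) a representation of it, and let (μ, F, G) and (μ′, F′, G′) be (2,3)-cocycles of A with coefficients in M such that μ − μ′ = μ_f, F − F′ = F_f, G − G′ = G_f for some linear map f : A → M, where μ_f(a,b) := f(a)·b + a·f(b) − f(a·b), F_f(a,b,c) := {f(a),b,c} + {a,f(b),c} + {a,b,f(c)} − f({a,b,c}), G_f(a,b,c) := ⦃f(a),b,c⦄ + ⦃a,f(b),c⦄ + ⦃a,b,f(c)⦄ − f(⦃a,b,c⦄). Then the bijective linear map Φ : A ⊕ M → A ⊕ M, Φ(a,u) := (a, u + f(a)), is an isomorphism of associative-Yamaguti algebras from the twisted semidirect product A ⊕_{(μ,F,G)} M to A ⊕_{(μ′,F′,G′)} M; that is, Φ((a,u)·⋉μ(b,v))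 = Φ(a,u)·⋉μ′Φ(b,v), Φ({(a,u),(b,v),(c,w)}⋉F) = {Φ(a,u),Φ(b,v),Φ(c,w)}⋉F′, and Φ(⦃(a,u),(b,v),(c,w)⦄⋉G) = ⦃Φ(a,u),Φ(b,v),Φ(c,w)⦄⋉G′. -/
set_option maxHeartbeats 1000000

/-- if two (2,3)-cocycles `(μ,F,G)` and `(μ',F',G')` differ by the
coboundary of a linear map `f : A → M`, then `Φ(a,u) = (a, u + f(a))` is a bijective
linear map which is an isomorphism of the corresponding twisted semidirect product
associative-Yamaguti algebras. -/
theorem coboundary_gives_isomorphism {k A M : Type*} [Field k] [CharZero k]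
    [AddCommGroup A] [Module k A] [AddCommGroup M] [Module k M]
    (mul : A →ₗ[k] A →ₗ[k] A) (tri tri' : A →ₗ[k] A →ₗ[k] A →ₗ[k] A)
    (al : A →ₗ[k] M →ₗ[k] M) (ar : M →ₗ[k] A →ₗ[k] M)
    (t0 : M →ₗ[k] A →ₗ[k] A →ₗ[k] M) (t1 : A →ₗ[k] M →ₗ[k] A →ₗ[k] M)
    (t2 : A →ₗ[k] A →ₗ[k] M →ₗ[k] M)
    (s0 : M →ₗ[k] A →ₗ[k] A →ₗ[k] M) (s1 : A →ₗ[k] M →ₗ[k] A →ₗ[k] M)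
    (s2 : A →ₗ[k] A →ₗ[k] M →ₗ[k] M)
    (hA : IsAssYamaguti mul tri tri')
    (hM : IsAssYRep mul tri tri' al ar t0 t1 t2 s0 s1 s2)
    (μ μ' : A →ₗ[k] A →ₗ[k] M) (F F' G G' : A →ₗ[k] A →ₗ[k] A →ₗ[k] M)
    (hco : Is23Cocycle mul tri tri' al ar t0 t1 t2 s0 s1 s2 μ F G)
    (hco' : Is23Cocycle mul tri tri' al ar t0 t1 t2 s0 s1 s2 μ' F' G')
    (f : A →ₗ[k] M)
    (hμ : ∀ a b : A, μ a b - μ' a b = ar (f a) b + al a (f b) - f (mul a b))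
    (hF : ∀ a b c : A,
      F a b c - F' a b c = t0 (f a) b c + t1 a (f b) c + t2 a b (f c) - f (tri a b c))
    (hG : ∀ a b c : A,
      G a b c - G' a b c = s0 (f a) b c + s1 a (f b) c + s2 a b (f c) - f (tri' a b c)) :
    ∃ Φ : (A × M) →ₗ[k] (A × M),
      (∀ p : A × M, Φ p = (p.1, p.2 + f p.1)) ∧
      Function.Bijective ⇑Φ ∧
      (∀ p q : A × M,
        Φ (mul p.1 q.1, al p.1 q.2 + ar p.2 q.1 + μ p.1 q.1) =
          (mul (Φ p).1 (Φ q).1,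
            al (Φ p).1 (Φ q).2 + ar (Φ p).2 (Φ q).1 + μ' (Φ p).1 (Φ q).1)) ∧
      (∀ p q r : A × M,
        Φ (tri p.1 q.1 r.1,
            t2 p.1 q.1 r.2 + t1 p.1 q.2 r.1 + t0 p.2 q.1 r.1 + F p.1 q.1 r.1) =
          (tri (Φ p).1 (Φ q).1 (Φ r).1,
            t2 (Φ p).1 (Φ q).1 (Φ r).2 + t1 (Φ p).1 (Φ q).2 (Φ r).1
              + t0 (Φ p).2 (Φ q).1 (Φ r).1 + F' (Φ p).1 (Φ q).1 (Φ r).1)) ∧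
      (∀ p q r : A × M,
        Φ (tri' p.1 q.1 r.1,
            s2 p.1 q.1 r.2 + s1 p.1 q.2 r.1 + s0 p.2 q.1 r.1 + G p.1 q.1 r.1) =
          (tri' (Φ p).1 (Φ q).1 (Φ r).1,
            s2 (Φ p).1 (Φ q).1 (Φ r).2 + s1 (Φ p).1 (Φ q).2 (Φ r).1
              + s0 (Φ p).2 (Φ q).1 (Φ r).1 + G' (Φ p).1 (Φ q).1 (Φ r).1)) := by
  have hΦ : ∀ p : A × M, (LinearEquiv.refl k A).skewProd (LinearEquiv.refl k M) f p =
      (p.1, p.2 + f p.1) := fun p => by simp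
  refine ⟨((LinearEquiv.refl k A).skewProd (LinearEquiv.refl k M) f).toLinearMap, hΦ,
    LinearEquiv.bijective _, ?_, ?_, ?_⟩
  · intro p q
    simp only [LinearEquiv.coe_coe, hΦ, map_add, LinearMap.add_apply, Prod.mk.injEq, true_and]
    rw [sub_eq_iff_eq_add.mp (hμ p.1 q.1)]
    abel
  · intro p q r
    simp only [LinearEquiv.coe_coe, hΦ, map_add, LinearMap.add_apply, Prod.mk.injEq, true_and]
    rw [sub_eq_iff_eq_add.mp (hF p.1 q.1 r.1)]
    abel
  · intro p q r
    simp only [LinearEquiv.coe_coe, hΦ, map_add, LinearMap.add_apply, Prod.mk.injEq, true_and]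
    rw [sub_eq_iff_eq_add.mp (hG p.1 q.1 r.1)]
    abel
end

section
/- Let D be a dendriform-Yamaguti algebra, i.e. a vector space with bilinear operations ≺, ≻ and trilinear operations { , , }_1, { , , }_2, { , , }_3, ⦃ , , ⦄_1, ⦃ , , ⦄_2, ⦃ , , ⦄_3 satisfying the identities (DY1A)–(DY11E). Define a·b := a≺b + a≻b, {a,b,c}_T := {a,b,c}_1 + {a,b,c}_2 + {a,b,c}_3, and ⦃a,b,c⦄_T := ⦃a,b,c⦄_1 + ⦃a,b,c⦄_2 + ⦃a,b,c⦄_3. Then (D, ·, { , , }_T, ⦃ , , ⦄_T) is an associative-Yamaguti algebra, i.e. the identities (AY1)–(AY11) hold for these total operations. -/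
set_option maxHeartbeats 1000000

/-- A dendriform-Yamaguti algebra structure: bilinear operations `pl` (`≺`), `pr` (`≻`)
and trilinear operations `T1, T2, T3` (`{ , , }_[1],[2],[3]`) and `S1, S2, S3`
(`⦃ , , ⦄_[1],[2],[3]`) satisfying the identities (DY1A)-(DY11E). -/
structure IsDendYamaguti {k D : Type*} [Field k] [AddCommGroup D] [Module k D]
    (pl pr : D →ₗ[k] D →ₗ[k] D)
    (T1 T2 T3 S1 S2 S3 : D →ₗ[k] D →ₗ[k] D →ₗ[k] D) : Prop where
  dy1a : ∀ a b c : D, pl (pl a b) c - pl a (pl b c + pr b c) + T1 a b c - S1 a b c = 0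
  dy1b : ∀ a b c : D, pl (pr a b) c - pr a (pl b c) + T2 a b c - S2 a b c = 0
  dy1c : ∀ a b c : D, pr (pl a b + pr a b) c - pr a (pr b c) + T3 a b c - S3 a b c = 0
  dy2a : ∀ a b c d : D, T1 (pl a b) c d = T1 a (pl b c + pr b c) d
  dy2b : ∀ a b c d : D, T1 (pr a b) c d = T2 a (pl b c) d
  dy2c : ∀ a b c d : D, T2 (pl a b + pr a b) c d = T2 a (pr b c) d
  dy2d : ∀ a b c d : D, T3 (pl a b + pr a b) c d = T3 a (pl b c + pr b c) d
  dy3a : ∀ a b c d : D, T1 a b (pl c d + pr c d) = pl (T1 a b c) d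
  dy3b : ∀ a b c d : D, T2 a b (pl c d + pr c d) = pl (T2 a b c) d
  dy3c : ∀ a b c d : D, T3 a b (pl c d) = pl (T3 a b c) d
  dy3d : ∀ a b c d : D, T3 a b (pr c d) = pr (T1 a b c + T2 a b c + T3 a b c) d
  dy4a : ∀ a b c d : D, S1 (pl a b) c d = pl a (S1 b c d + S2 b c d + S3 b c d)
  dy4b : ∀ a b c d : D, S1 (pr a b) c d = pr a (S1 b c d)
  dy4c : ∀ a b c d : D, S2 (pl a b + pr a b) c d = pr a (S2 b c d)
  dy4d : ∀ a b c d : D, S3 (pl a b + pr a b) c d = pr a (S3 b c d)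
  dy5a : ∀ a b c d : D, S1 a (pl b c + pr b c) d = S1 a b (pl c d + pr c d)
  dy5b : ∀ a b c d : D, S2 a (pl b c) d = S2 a b (pl c d + pr c d)
  dy5c : ∀ a b c d : D, S2 a (pr b c) d = S3 a b (pl c d)
  dy5d : ∀ a b c d : D, S3 a (pl b c + pr b c) d = S3 a b (pr c d)
  dy6a : ∀ a b c d : D, pl a (T1 b c d + T2 b c d + T3 b c d) = pl (S1 a b c) d
  dy6b : ∀ a b c d : D, pr a (T1 b c d) = pl (S2 a b c) d
  dy6c : ∀ a b c d : D, pr a (T2 b c d) = pl (S3 a b c) d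
  dy6d : ∀ a b c d : D, pr a (T3 b c d) = pr (S1 a b c + S2 a b c + S3 a b c) d
  dy7a1 : ∀ a b c d e : D, T1 (T1 a b c) d e = T1 a (S1 b c d + S2 b c d + S3 b c d) e
  dy7a2 : ∀ a b c d e : D,
    T1 a (S1 b c d + S2 b c d + S3 b c d) e = T1 a b (T1 c d e + T2 c d e + T3 c d e)
  dy7b1 : ∀ a b c d e : D, T1 (T2 a b c) d e = T2 a (S1 b c d) e
  dy7b2 : ∀ a b c d e : D, T2 a (S1 b c d) e = T2 a b (T1 c d e + T2 c d e + T3 c d e)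
  dy7c1 : ∀ a b c d e : D, T1 (T3 a b c) d e = T2 a (S2 b c d) e
  dy7c2 : ∀ a b c d e : D, T2 a (S2 b c d) e = T3 a b (T1 c d e)
  dy7d1 : ∀ a b c d e : D, T2 (T1 a b c + T2 a b c + T3 a b c) d e = T2 a (S3 b c d) e
  dy7d2 : ∀ a b c d e : D, T2 a (S3 b c d) e = T3 a b (T2 c d e)
  dy7e1 : ∀ a b c d e : D,
    T3 (T1 a b c + T2 a b c + T3 a b c) d e = T3 a (S1 b c d + S2 b c d + S3 b c d) e
  dy7e2 : ∀ a b c d e : D, T3 a (S1 b c d + S2 b c d + S3 b c d) e = T3 a b (T3 c d e)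
  dy8a : ∀ a b c d e : D, T1 a (T1 b c d + T2 b c d + T3 b c d) e = T1 (S1 a b c) d e
  dy8b : ∀ a b c d e : D, T2 a (T1 b c d) e = T1 (S2 a b c) d e
  dy8c : ∀ a b c d e : D, T2 a (T2 b c d) e = T1 (S3 a b c) d e
  dy8d : ∀ a b c d e : D, T2 a (T3 b c d) e = T2 (S1 a b c + S2 a b c + S3 a b c) d e
  dy8e : ∀ a b c d e : D,
    T3 a (T1 b c d + T2 b c d + T3 b c d) e = T3 (S1 a b c + S2 a b c + S3 a b c) d e
  dy9a1 : ∀ a b c d e : D, S1 (S1 a b c) d e = S1 a (T1 b c d + T2 b c d + T3 b c d) e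
  dy9a2 : ∀ a b c d e : D,
    S1 a (T1 b c d + T2 b c d + T3 b c d) e = S1 a b (S1 c d e + S2 c d e + S3 c d e)
  dy9b1 : ∀ a b c d e : D, S1 (S2 a b c) d e = S2 a (T1 b c d) e
  dy9b2 : ∀ a b c d e : D, S2 a (T1 b c d) e = S2 a b (S1 c d e + S2 c d e + S3 c d e)
  dy9c1 : ∀ a b c d e : D, S1 (S3 a b c) d e = S2 a (T2 b c d) e
  dy9c2 : ∀ a b c d e : D, S2 a (T2 b c d) e = S3 a b (S1 c d e)
  dy9d1 : ∀ a b c d e : D, S2 (S1 a b c + S2 a b c + S3 a b c) d e = S2 a (T3 b c d) e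
  dy9d2 : ∀ a b c d e : D, S2 a (T3 b c d) e = S3 a b (S2 c d e)
  dy9e1 : ∀ a b c d e : D,
    S3 (S1 a b c + S2 a b c + S3 a b c) d e = S3 a (T1 b c d + T2 b c d + T3 b c d) e
  dy9e2 : ∀ a b c d e : D, S3 a (T1 b c d + T2 b c d + T3 b c d) e = S3 a b (S3 c d e)
  dy10a : ∀ a b c d e : D,
    S1 a (S1 b c d + S2 b c d + S3 b c d) e = S1 a b (T1 c d e + T2 c d e + T3 c d e)
  dy10b : ∀ a b c d e : D, S2 a (S1 b c d) e = S2 a b (T1 c d e + T2 c d e + T3 c d e)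
  dy10c : ∀ a b c d e : D, S2 a (S2 b c d) e = S3 a b (T1 c d e)
  dy10d : ∀ a b c d e : D, S2 a (S3 b c d) e = S3 a b (T2 c d e)
  dy10e : ∀ a b c d e : D, S3 a (S1 b c d + S2 b c d + S3 b c d) e = S3 a b (T3 c d e)
  dy11a : ∀ a b c d e : D, T1 a b (S1 c d e + S2 c d e + S3 c d e) = S1 (T1 a b c) d e
  dy11b : ∀ a b c d e : D, T2 a b (S1 c d e + S2 c d e + S3 c d e) = S1 (T2 a b c) d e
  dy11c : ∀ a b c d e : D, T3 a b (S1 c d e) = S1 (T3 a b c) d e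
  dy11d : ∀ a b c d e : D, T3 a b (S2 c d e) = S2 (T1 a b c + T2 a b c + T3 a b c) d e
  dy11e : ∀ a b c d e : D, T3 a b (S3 c d e) = S3 (T1 a b c + T2 a b c + T3 a b c) d e

/-- the total operations `a·b = a≺b + a≻b`, `{ , , }_T = Σ { , , }_i`,
`⦃ , , ⦄_T = Σ ⦃ , , ⦄_i` of a dendriform-Yamaguti algebra form an
associative-Yamaguti algebra. -/
theorem dendYamaguti_total_is_assYamaguti {k D : Type*} [Field k] [CharZero k]
    [AddCommGroup D] [Module k D]
    (pl pr : D →ₗ[k] D →ₗ[k] D)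
    (T1 T2 T3 S1 S2 S3 : D →ₗ[k] D →ₗ[k] D →ₗ[k] D)
    (h : IsDendYamaguti pl pr T1 T2 T3 S1 S2 S3) :
    IsAssYamaguti (pl + pr) (T1 + T2 + T3) (S1 + S2 + S3) := by
  constructor
  case ay1 =>
    intro a b c
    linear_combination (norm := (simp only [map_add, LinearMap.add_apply]; abel))
      h.dy1a a b c + h.dy1b a b c + h.dy1c a b c
  case ay2 =>
    intro a b c d
    linear_combination (norm := (simp only [map_add, LinearMap.add_apply]; abel))
      h.dy2a a b c d + h.dy2b a b c d + h.dy2c a b c d + h.dy2d a b c d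
  case ay3 =>
    intro a b c d
    linear_combination (norm := (simp only [map_add, LinearMap.add_apply]; abel))
      h.dy3a a b c d + h.dy3b a b c d + h.dy3c a b c d + h.dy3d a b c d
  case ay4 =>
    intro a b c d
    linear_combination (norm := (simp only [map_add, LinearMap.add_apply]; abel))
      h.dy4a a b c d + h.dy4b a b c d + h.dy4c a b c d + h.dy4d a b c d
  case ay5 =>
    intro a b c d
    linear_combination (norm := (simp only [map_add, LinearMap.add_apply]; abel))
      h.dy5a a b c d + h.dy5b a b c d + h.dy5c a b c d + h.dy5d a b c d
  case ay6 =>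
    intro a b c d
    linear_combination (norm := (simp only [map_add, LinearMap.add_apply]; abel))
      h.dy6a a b c d + h.dy6b a b c d + h.dy6c a b c d + h.dy6d a b c d
  case ay7a =>
    intro a b c d e
    linear_combination (norm := (simp only [map_add, LinearMap.add_apply]; abel))
      h.dy7a1 a b c d e + h.dy7b1 a b c d e + h.dy7c1 a b c d e +
        h.dy7d1 a b c d e + h.dy7e1 a b c d e
  case ay7b =>
    intro a b c d e
    linear_combination (norm := (simp only [map_add, LinearMap.add_apply]; abel))
      h.dy7a2 a b c d e + h.dy7b2 a b c d e + h.dy7c2 a b c d e +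
        h.dy7d2 a b c d e + h.dy7e2 a b c d e
  case ay8 =>
    intro a b c d e
    linear_combination (norm := (simp only [map_add, LinearMap.add_apply]; abel))
      h.dy8a a b c d e + h.dy8b a b c d e + h.dy8c a b c d e +
        h.dy8d a b c d e + h.dy8e a b c d e
  case ay9a =>
    intro a b c d e
    linear_combination (norm := (simp only [map_add, LinearMap.add_apply]; abel))
      h.dy9a1 a b c d e + h.dy9b1 a b c d e + h.dy9c1 a b c d e +
        h.dy9d1 a b c d e + h.dy9e1 a b c d e
  case ay9b =>
    intro a b c d e
    linear_combination (norm := (simp only [map_add, LinearMap.add_apply]; abel))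
      h.dy9a2 a b c d e + h.dy9b2 a b c d e + h.dy9c2 a b c d e +
        h.dy9d2 a b c d e + h.dy9e2 a b c d e
  case ay10 =>
    intro a b c d e
    linear_combination (norm := (simp only [map_add, LinearMap.add_apply]; abel))
      h.dy10a a b c d e + h.dy10b a b c d e + h.dy10c a b c d e +
        h.dy10d a b c d e + h.dy10e a b c d e
  case ay11 =>
    intro a b c d e
    linear_combination (norm := (simp only [map_add, LinearMap.add_apply]; abel))
      h.dy11a a b c d e + h.dy11b a b c d e + h.dy11c a b c d e +
        h.dy11d a b c d e + h.dy11e a b c d e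
end
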